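/- arXiv:2404.00222 — 4 statements merged into one kernel-verified Lean document; each statement's English description precedes it below -/
import Mathlib

section
/- Let q = p^k be a prime power with q ≡ 3 (mod 4), and let f : F_q → F_q. Then f preserves positivity on M_2(F_q) if and only if f is a positive multiple of a field automorphism of F_q, i.e., there exist c ∈ F_q^+ and an integer ℓ with 0 ≤ ℓ ≤ k−1 such that f(x) = c·x^{p^ℓ} for all x ∈ F_q. -/
/-- An element of a field is *positive* if it is a nonzero square. -/
def IsPos {F : Type*} [Field F] (x : F) : Prop := ∃ y : F, y ≠ 0 ∧ y ^ 2 = x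

/-- The `r`-th leading principal minor of a square matrix (the determinant of the
top-left `(r+1) × (r+1)` submatrix). -/
def leadingMinor {F : Type*} [CommRing F] {n : ℕ} (A : Matrix (Fin n) (Fin n) F)
    (r : Fin n) : F :=
  (A.submatrix (Fin.castLE r.isLt) (Fin.castLE r.isLt)).det

/-- A matrix over a finite field is positive definite if it is symmetric and all its
leading principal minors are positive (nonzero squares). -/
def IsPosDef {F : Type*} [Field F] {n : ℕ} (A : Matrix (Fin n) (Fin n) F) : Prop :=
  A.IsSymm ∧ ∀ r : Fin n, IsPos (leadingMinor A r)

/-- The entrywise application `f[A]` of `f` to the matrix `A`. -/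
def entrywiseMap {F : Type*} {n : ℕ} (f : F → F) (A : Matrix (Fin n) (Fin n) F) :
    Matrix (Fin n) (Fin n) F := Matrix.of fun i j => f (A i j)

/-- `f` preserves positivity on `n × n` matrices. -/
def PreservesPos {F : Type*} [Field F] (n : ℕ) (f : F → F) : Prop :=
  ∀ A : Matrix (Fin n) (Fin n) F, IsPosDef A → IsPosDef (entrywiseMap f A)

theorem isPos_ne_zero {F : Type*} [Field F] {x : F} (h : IsPos x) : x ≠ 0 := by
  obtain ⟨y, hy, rfl⟩ := h
  exact pow_ne_zero 2 hy

theorem IsPos.mul {F : Type*} [Field F] {x y : F} (hx : IsPos x) (hy : IsPos y) :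
    IsPos (x * y) := by
  obtain ⟨a, ha, rfl⟩ := hx
  obtain ⟨b, hb, rfl⟩ := hy
  exact ⟨a * b, mul_ne_zero ha hb, mul_pow a b 2⟩

theorem IsPos.inv {F : Type*} [Field F] {x : F} (hx : IsPos x) : IsPos x⁻¹ := by
  obtain ⟨a, ha, rfl⟩ := hx
  exact ⟨a⁻¹, inv_ne_zero ha, inv_pow a 2⟩

theorem IsPos.pow {F : Type*} [Field F] {x : F} (hx : IsPos x) (m : ℕ) : IsPos (x ^ m) := by
  obtain ⟨a, ha, rfl⟩ := hx
  exact ⟨a ^ m, pow_ne_zero m ha, pow_right_comm a m 2⟩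

theorem isPos_one {F : Type*} [Field F] : IsPos (1 : F) := ⟨1, one_ne_zero, one_pow 2⟩

theorem isPos_mul_self {F : Type*} [Field F] {x : F} (h : x ≠ 0) : IsPos (x * x) :=
  ⟨x, h, sq x⟩

theorem IsPos.of_mul_left {F : Type*} [Field F] {x y : F} (hx : IsPos x) (h : IsPos (x * y)) :
    IsPos y := by
  have := hx.inv.mul h
  rwa [inv_mul_cancel_left₀ (isPos_ne_zero hx)] at this

theorem not_isPos_zero {F : Type*} [Field F] : ¬ IsPos (0 : F) := fun h => isPos_ne_zero h rfl

theorem IsPos.not_neg {F : Type*} [Field F] [Fintype F] (hq : Fintype.card F % 4 = 3) {x : F}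
    (hx : IsPos x) : ¬ IsPos (-x) := by
  intro h
  rw [← mul_neg_one] at h
  obtain ⟨y, -, hy⟩ := hx.of_mul_left h
  exact (FiniteField.isSquare_neg_one_iff.mp ⟨y, by rw [← hy, sq]⟩) hq

theorem isPos_or_isPos_neg {F : Type*} [Field F] [Fintype F] (hq : Fintype.card F % 4 = 3) {x : F}
    (hx : x ≠ 0) : IsPos x ∨ IsPos (-x) := by
  have hF : ringChar F ≠ 2 := by
    intro h
    have := FiniteField.even_card_of_char_two h
    omega
  have hodd : Odd (Fintype.card F / 2) := by
    rw [Nat.odd_iff]; omega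
  have aux : ∀ z : F, z ≠ 0 → z ^ (Fintype.card F / 2) = 1 → IsPos z := by
    intro z hz h
    obtain ⟨y, rfl⟩ := (FiniteField.isSquare_iff hF hz).mpr h
    exact isPos_mul_self (by rintro rfl; simp at hz)
  rcases FiniteField.pow_dichotomy hF hx with h | h
  · exact Or.inl (aux x hx h)
  · exact Or.inr (aux (-x) (neg_ne_zero.mpr hx) (by rw [hodd.neg_pow, h, neg_neg]))

theorem preservesPos_two_iff {F : Type*} [Field F] (f : F → F) :
    PreservesPos 2 f ↔ ∀ a b c : F, IsPos a → IsPos (a * c - b * b) →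
      IsPos (f a) ∧ IsPos (f a * f c - f b * f b) := by
  have key : ∀ A : Matrix (Fin 2) (Fin 2) F, IsPosDef A ↔
      A 0 1 = A 1 0 ∧ IsPos (A 0 0) ∧ IsPos (A 0 0 * A 1 1 - A 0 1 * A 1 0) := by
    intro A
    have h0 : leadingMinor A 0 = A 0 0 := by
      simp only [leadingMinor]
      exact Matrix.det_fin_one _
    have h1 : leadingMinor A 1 = A 0 0 * A 1 1 - A 0 1 * A 1 0 := by
      simp only [leadingMinor]
      exact Matrix.det_fin_two _
    rw [IsPosDef, Fin.forall_fin_two, h0, h1]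
    refine and_congr_left fun _ => ⟨fun h => h.apply 1 0, fun h => ?_⟩
    ext i j
    fin_cases i <;> fin_cases j <;> simp [h]
  constructor
  · intro h a b c ha hd
    have := (key _).mp (h !![a, b; b, c] ((key _).mpr ⟨rfl, ha, hd⟩))
    exact this.2
  · intro h A hA
    obtain ⟨h1, h2, h3⟩ := (key A).mp hA
    rw [← h1] at h3
    obtain ⟨h4, h5⟩ := h _ _ _ h2 h3
    refine (key _).mpr ⟨?_, h4, ?_⟩
    · simp [entrywiseMap, h1]
    · simpa [entrywiseMap, ← h1] using h5

theorem map_sub_isPos_of_preserves {F : Type*} [Field F]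
    {f : F → F} (hf : PreservesPos 2 f) {a b : F} (ha : IsPos a) (h : IsPos (b - a)) :
    IsPos (f b - f a) := by
  have hf := (preservesPos_two_iff f).mp hf
  obtain ⟨h1, h2⟩ := hf a a b ha (by rw [← mul_sub]; exact ha.mul h)
  rw [← mul_sub] at h2
  exact h1.of_mul_left h2

theorem map_isPos_of_preserves {F : Type*} [Field F]
    {f : F → F} (hf : PreservesPos 2 f) {a : F} (ha : IsPos a) : IsPos (f a) :=
  ((preservesPos_two_iff f).mp hf a 0 a ha (by simpa using ha.mul ha)).1

theorem injOn_isPos_of_preserves {F : Type*} [Field F] [Fintype F]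
    (hq : Fintype.card F % 4 = 3) {f : F → F} (hf : PreservesPos 2 f) :
    Set.InjOn f {x | IsPos x} := by
  intro a ha b hb hab
  by_contra hne
  rcases isPos_or_isPos_neg hq (sub_ne_zero.mpr hne) with h | h
  · have := map_sub_isPos_of_preserves hf hb h
    rw [hab, sub_self] at this
    exact not_isPos_zero this
  · rw [neg_sub] at h
    have := map_sub_isPos_of_preserves hf ha h
    rw [hab, sub_self] at this
    exact not_isPos_zero this

theorem exists_isPos_map_eq_of_preserves {F : Type*} [Field F] [Fintype F]
    (hq : Fintype.card F % 4 = 3) {f : F → F} (hf : PreservesPos 2 f) {y : F} (hy : IsPos y) :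
    ∃ x, IsPos x ∧ f x = y := by
  classical
  have := Finset.surjOn_of_injOn_of_card_le (s := Finset.univ.filter (IsPos (F := F)))
    (t := Finset.univ.filter (IsPos (F := F))) f
    (by intro x hx; simp at hx ⊢; exact map_isPos_of_preserves hf hx)
    (by simpa using injOn_isPos_of_preserves hq hf) le_rfl
  obtain ⟨x, hx, h⟩ := this (by simpa using hy)
  exact ⟨x, by simpa using hx, h⟩

theorem isPos_of_map_sub_isPos {F : Type*} [Field F] [Fintype F]
    (hq : Fintype.card F % 4 = 3) {f : F → F} (hf : PreservesPos 2 f) {a b : F}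
    (hb : IsPos b) (h : IsPos (f b - f a)) : IsPos (b - a) := by
  by_cases hab : b = a
  · subst hab
    rw [sub_self] at h
    exact absurd h not_isPos_zero
  rcases isPos_or_isPos_neg hq (sub_ne_zero.mpr hab) with h' | h'
  · exact h'
  · rw [neg_sub] at h'
    have := map_sub_isPos_of_preserves hf hb h'
    rw [← neg_sub] at this
    exact absurd this (h.not_neg hq)

theorem map_zero_of_preserves {F : Type*} [Field F] [Fintype F]
    (hq : Fintype.card F % 4 = 3) {f : F → F} (hf : PreservesPos 2 f) : f 0 = 0 := by
  by_contra h0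
  obtain ⟨a, ha, h⟩ := exists_isPos_map_eq_of_preserves hq hf (isPos_mul_self h0)
  obtain ⟨b, hb, h'⟩ := exists_isPos_map_eq_of_preserves hq hf (isPos_one (F := F))
  have := ((preservesPos_two_iff f).mp hf a 0 b ha (by simpa using ha.mul hb)).2
  rw [h, h', mul_one, sub_self] at this
  exact not_isPos_zero this

/-- The up-sets `{t | 0 < t, s < t}` with `s` positive form an antichain for inclusion. -/
theorem eq_of_forall_isPos_sub {F : Type*} [Field F] [Fintype F]
    (hq : Fintype.card F % 4 = 3) {s v : F} (hs : IsPos s) (hv : IsPos v)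
    (h : ∀ t, IsPos t → IsPos (t - s) → IsPos (t - v)) : s = v := by
  classical
  let U : F → Finset F := fun s => Finset.univ.filter fun t => IsPos t ∧ IsPos (t - s)
  have hsub : U s ⊆ U v := by
    intro t ht
    simp only [U, Finset.mem_filter, Finset.mem_univ, true_and] at ht ⊢
    exact ⟨ht.1, h t ht.1 ht.2⟩
  have hs0 := isPos_ne_zero hs
  have hv0 := isPos_ne_zero hv
  have hcard : (U v).card ≤ (U s).card := by
    refine Finset.card_le_card_of_injOn (fun t => s * v⁻¹ * t) ?_ ?_
    · intro t ht
      simp only [U, Finset.coe_filter, Finset.mem_univ, true_and, Set.mem_ofPred_eq] at ht ⊢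
      refine ⟨(hs.mul hv.inv).mul ht.1, ?_⟩
      have := (hs.mul hv.inv).mul ht.2
      rwa [mul_sub, inv_mul_cancel_right₀ hv0] at this
    · intro x _ y _ hxy
      exact mul_left_cancel₀ (mul_ne_zero hs0 (inv_ne_zero hv0)) hxy
  have heq := Finset.eq_of_subset_of_card_le hsub hcard
  by_contra hne
  rcases isPos_or_isPos_neg hq (sub_ne_zero.mpr hne) with h' | h'
  · have : s ∈ U s := heq ▸ (by simp [U, hs, h'])
    simp [U, not_isPos_zero] at this
  · rw [neg_sub] at h'
    have : v ∈ U v := heq ▸ (by simp [U, hv, h'])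
    simp [U, not_isPos_zero] at this

theorem map_div_mul_of_preserves {F : Type*} [Field F] [Fintype F]
    (hq : Fintype.card F % 4 = 3) {f : F → F} (hf : PreservesPos 2 f) {a b : F}
    (ha : IsPos a) (hb : b ≠ 0) (hfb : f b ≠ 0) : f (b * b / a) * f a = f b * f b := by
  have hfa := map_isPos_of_preserves hf ha
  have hw : IsPos (b * b / a) := by
    rw [div_eq_mul_inv]; exact (isPos_mul_self hb).mul ha.inv
  rw [← eq_div_iff (isPos_ne_zero hfa)]
  refine eq_of_forall_isPos_sub hq (map_isPos_of_preserves hf hw) ?_ ?_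
  · rw [div_eq_mul_inv]; exact (isPos_mul_self hfb).mul hfa.inv
  · intro t ht hts
    obtain ⟨c, hc, rfl⟩ := exists_isPos_map_eq_of_preserves hq hf ht
    have h1 := isPos_of_map_sub_isPos hq hf hc hts
    have h2 := ((preservesPos_two_iff f).mp hf a b c ha ?_).2
    · have := hfa.inv.mul h2
      convert this using 1
      field_simp [isPos_ne_zero hfa]
    · convert ha.mul h1 using 1
      field_simp [isPos_ne_zero ha]

theorem map_mul_of_isPos_of_preserves {F : Type*} [Field F] [Fintype F]
    (hq : Fintype.card F % 4 = 3) {f : F → F} (hf : PreservesPos 2 f) {x y : F}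
    (hx : IsPos x) (hy : IsPos y) : f (x * y) * f 1 = f x * f y := by
  have key : ∀ {w : F}, IsPos w → ∃ z, IsPos z ∧ z * z = w := by
    rintro _ ⟨z, hz, rfl⟩
    rcases isPos_or_isPos_neg hq hz with h | h
    · exact ⟨z, h, (sq z).symm⟩
    · exact ⟨-z, h, by ring⟩
  obtain ⟨z, hz, h⟩ := key (hx.mul hy)
  have hfz := isPos_ne_zero (map_isPos_of_preserves hf hz)
  have h1 := map_div_mul_of_preserves hq hf isPos_one (isPos_ne_zero hz) hfz
  have h2 := map_div_mul_of_preserves hq hf hy (isPos_ne_zero hz) hfz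
  rw [h, div_one] at h1
  rw [h, mul_div_cancel_right₀ _ (isPos_ne_zero hy)] at h2
  rw [h1, h2]

theorem exists_isPos_neg_add_sq {F : Type*} [Field F] [Fintype F]
    (hq : Fintype.card F % 4 = 3) {c : F} (hc : IsPos (-c)) :
    ∃ a b : F, IsPos a ∧ IsPos (a * c - b * b) := by
  have hm : ¬ IsPos (-1 : F) := isPos_one.not_neg hq
  have hF : ringChar F ≠ 2 := by
    intro h
    have := FiniteField.even_card_of_char_two h
    omega
  obtain ⟨x, y, hxy⟩ := FiniteField.exists_root_sum_quadratic
    (f := (Polynomial.X ^ 2 : Polynomial F)) (g := Polynomial.X ^ 2 + Polynomial.C 1)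
    (by simp) (by compute_degree!) (by
      rw [← Nat.card_eq_fintype_card] at hq
      rw [← Nat.card_eq_fintype_card]; omega)
  simp at hxy
  have hx : x ≠ 0 := by
    rintro rfl
    refine hm ⟨y, ?_, by linear_combination hxy⟩
    rintro rfl
    simp at hxy
  refine ⟨x * x * (-c)⁻¹, y, (isPos_mul_self hx).mul hc.inv, ?_⟩
  have hc0 : c ≠ 0 := by simpa using isPos_ne_zero hc
  convert isPos_one (F := F) using 1
  field_simp
  linear_combination -hxy

theorem map_neg_of_isPos_of_preserves {F : Type*} [Field F] [Fintype F]
    (hq : Fintype.card F % 4 = 3) {f : F → F} (hf : PreservesPos 2 f) {b : F}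
    (hb : IsPos b) : f (-b) = -f b := by
  classical
  have hb0 := isPos_ne_zero hb
  have hfb0 := isPos_ne_zero (map_isPos_of_preserves hf hb)
  have h0 : f (-b) ≠ 0 := by
    intro h
    obtain ⟨a, d, ha, had⟩ := exists_isPos_neg_add_sq hq (c := -b) (by rwa [neg_neg])
    have h2 := ((preservesPos_two_iff f).mp hf a d (-b) ha had).2
    rw [h, mul_zero, zero_sub] at h2
    refine (isPos_mul_self (x := f d) ?_).not_neg hq h2
    intro h; simp [h, not_isPos_zero] at h2
  have hsq := map_div_mul_of_preserves hq hf hb (neg_ne_zero.mpr hb0) h0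
  rw [neg_mul_neg, mul_div_cancel_right₀ _ hb0] at hsq
  rcases mul_self_eq_mul_self_iff.mp hsq.symm with h | h
  swap
  · exact h
  exfalso
  have key : ∀ a : F, IsPos a → IsPos (-(a + 1)) → IsPos (a - 1) := by
    intro a ha h1
    have hab := hb.mul ha
    have h2 := ((preservesPos_two_iff f).mp hf (b * a) b (-b) hab ?_).2
    · rw [h, ← sub_mul, mul_comm] at h2
      have h3 := (map_isPos_of_preserves hf hb).of_mul_left h2
      have h4 := isPos_of_map_sub_isPos hq hf hab h3
      rw [← mul_sub_one] at h4
      exact hb.of_mul_left h4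
    · convert (isPos_mul_self hb0).mul h1 using 1
      ring
  have hm : ¬ IsPos (-1 : F) := isPos_one.not_neg hq
  have key' : ∀ a : F, IsPos a → ¬ IsPos (a - 1) → IsPos (a + 1) := by
    intro a ha h1
    have : a + 1 ≠ 0 := by
      intro h
      rw [add_eq_zero_iff_eq_neg] at h
      exact hm (h ▸ ha)
    rcases isPos_or_isPos_neg hq this with h | h
    · exact h
    · exact absurd (key a ha h) h1
  let S : Finset F := Finset.univ.filter fun t => IsPos t ∧ IsPos (t - 1)
  have h1S : (1 : F) ∉ S := by simp [S, not_isPos_zero]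
  have hle : (insert 1 S).card ≤ S.card := by
    refine Finset.card_le_card_of_injOn (fun t => t⁻¹ + 1) ?_ ?_
    · intro t ht
      simp only [S, Finset.coe_insert, Finset.coe_filter, Finset.mem_univ, true_and,
        Set.mem_insert_iff, Set.mem_ofPred_eq] at ht ⊢
      rcases ht with rfl | ⟨ht, ht1⟩
      · rw [inv_one, add_sub_cancel_right]
        exact ⟨key' 1 isPos_one (by rw [sub_self]; exact not_isPos_zero), isPos_one⟩
      · rw [add_sub_cancel_right]
        refine ⟨key' _ ht.inv fun h => ?_, ht.inv⟩
        refine ht1.not_neg hq ?_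
        convert ht.mul h using 1
        field_simp [isPos_ne_zero ht]
        ring
    · intro x _ y _ hxy
      simpa using hxy
  rw [Finset.card_insert_of_notMem h1S] at hle
  omega

/-- A preserver of positivity is odd. -/
theorem map_neg_of_preserves {F : Type*} [Field F] [Fintype F]
    (hq : Fintype.card F % 4 = 3) {f : F → F} (hf : PreservesPos 2 f) (x : F) :
    f (-x) = -f x := by
  by_cases hx : x = 0
  · simp [hx, map_zero_of_preserves hq hf]
  rcases isPos_or_isPos_neg hq hx with h | h
  · exact map_neg_of_isPos_of_preserves hq hf h
  · have := map_neg_of_isPos_of_preserves hq hf h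
    rw [neg_neg] at this
    rw [this, neg_neg]

theorem map_mul_of_preserves {F : Type*} [Field F] [Fintype F]
    (hq : Fintype.card F % 4 = 3) {f : F → F} (hf : PreservesPos 2 f) (x y : F) :
    f (x * y) * f 1 = f x * f y := by
  have h0 := map_zero_of_preserves hq hf
  have hn := map_neg_of_preserves hq hf
  by_cases hx : x = 0
  · simp [hx, h0]
  by_cases hy : y = 0
  · simp [hy, h0]
  rcases isPos_or_isPos_neg hq hx with hx | hx <;> rcases isPos_or_isPos_neg hq hy with hy | hy <;>
  simpa [hn] using map_mul_of_isPos_of_preserves hq hf hx hy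

theorem injective_of_preserves {F : Type*} [Field F] [Fintype F]
    (hq : Fintype.card F % 4 = 3) {f : F → F} (hf : PreservesPos 2 f) :
    Function.Injective f := by
  have h0 := map_zero_of_preserves hq hf
  have hn := map_neg_of_preserves hq hf
  have hne : ∀ x, x ≠ 0 → f x ≠ 0 := by
    intro x hx h
    rcases isPos_or_isPos_neg hq hx with hx | hx <;>
    simpa [hn, h] using isPos_ne_zero (map_isPos_of_preserves hf hx)
  have hpos : ∀ {x y}, IsPos x → f x = f y → x = y := by
    intro x y hx hxy
    have hfx := map_isPos_of_preserves hf hx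
    by_cases hy : y = 0
    · exact absurd (hxy.trans (hy ▸ h0)) (isPos_ne_zero hfx)
    rcases isPos_or_isPos_neg hq hy with hy | hy
    · exact injOn_isPos_of_preserves hq hf hx hy hxy
    · have := map_isPos_of_preserves hf hy
      rw [hn, ← hxy] at this
      exact absurd this (hfx.not_neg hq)
  intro x y hxy
  by_cases hx : x = 0
  · by_contra hne'
    exact hne y (by rintro rfl; exact hne' hx) (by rw [← hxy, hx, h0])
  rcases isPos_or_isPos_neg hq hx with hx | hx
  · exact hpos hx hxy
  · exact neg_injective (hpos hx (by rw [hn, hn, hxy]))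

theorem map_one_sub_map_isPos_of_preserves {F : Type*} [Field F] [Fintype F]
    (hq : Fintype.card F % 4 = 3) {f : F → F} (hf : PreservesPos 2 f) {x : F}
    (h : IsPos (1 - x)) : IsPos (f 1 - f x) := by
  have h0 := map_zero_of_preserves hq hf
  have hn := map_neg_of_preserves hq hf
  have hf1 := map_isPos_of_preserves hf (isPos_one (F := F))
  by_cases hx : x = 0
  · simpa [hx, h0] using hf1
  rcases isPos_or_isPos_neg hq hx with hx' | hx'
  · exact map_sub_isPos_of_preserves hf hx' h
  by_cases hx1 : x = -1
  · have h2 : IsPos (1 + f 1 / f 1) := by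
      rw [div_self (isPos_ne_zero hf1)]
      simpa [hx1] using h
    convert hf1.mul h2 using 1
    rw [hx1, hn]
    field_simp [isPos_ne_zero hf1]
    ring
  have hfx : IsPos (-f x) := by rw [← hn]; exact map_isPos_of_preserves hf hx'
  have hxx := map_mul_of_preserves hq hf x x
  have hx1' : -x - 1 ≠ 0 := fun h => hx1 (by linear_combination -h)
  have hid : (f 1 - f x) * (f (-x) - f 1) = f 1 * (f (x * x) - f 1) := by
    rw [hn]
    linear_combination -hxx
  rcases isPos_or_isPos_neg hq hx1' with h1 | h1
  · have h2 := map_sub_isPos_of_preserves hf isPos_one h1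
    have h3 : IsPos (x * x - 1) := by
      convert h.mul h1 using 1; ring
    have h4 := hf1.mul (map_sub_isPos_of_preserves hf isPos_one h3)
    rw [← hid, mul_comm] at h4
    exact h2.of_mul_left h4
  · rw [neg_sub] at h1
    have h2 := map_sub_isPos_of_preserves hf hx' h1
    have h3 : IsPos (1 - x * x) := by
      convert h.mul h1 using 1; ring
    have h4 := hf1.mul (map_sub_isPos_of_preserves hf (isPos_mul_self hx) h3)
    refine h2.of_mul_left ?_
    convert h4 using 1
    linear_combination -hid

theorem sum_digit_mul_pow_lt {p : ℕ} (k : ℕ) (d : Fin k → ℕ) (hd : ∀ i, d i < p) :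
    ∑ i, d i * p ^ (i : ℕ) < p ^ k := by
  induction k with
  | zero => simp
  | succ k ih =>
    have := ih (fun i => d i.succ) fun i => hd _
    rw [Fin.sum_univ_succ]
    simp only [Fin.val_zero, pow_zero, mul_one, Fin.val_succ, pow_succ, ← mul_assoc,
      ← Finset.sum_mul]
    have h0 := hd 0
    nlinarith

theorem sum_digit_mul_pow_div_mod {p : ℕ} (k : ℕ) (d : Fin k → ℕ) (hd : ∀ i, d i < p)
    (j : Fin k) : (∑ i, d i * p ^ (i : ℕ)) / p ^ (j : ℕ) % p = d j := by
  induction k with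
  | zero => exact j.elim0
  | succ k ih =>
    have hp : 0 < p := (Nat.zero_le _).trans_lt (hd 0)
    rw [Fin.sum_univ_succ]
    simp only [Fin.val_zero, pow_zero, mul_one, Fin.val_succ, pow_succ, ← mul_assoc,
      ← Finset.sum_mul]
    refine Fin.cases ?_ (fun j => ?_) j
    · simp [Nat.mod_eq_of_lt (hd 0)]
    · rw [Fin.val_succ, pow_succ', ← Nat.div_div_eq_div_mul, Nat.add_mul_div_right _ _ hp,
        Nat.div_eq_of_lt (hd 0), zero_add]
      exact ih (fun i => d i.succ) (fun i => hd _) j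

theorem sum_div_mod_mul_pow {p : ℕ} (k m : ℕ) (hm : m < p ^ k) :
    ∑ i : Fin k, m / p ^ (i : ℕ) % p * p ^ (i : ℕ) = m := by
  induction k generalizing m with
  | zero => simp at hm ⊢; omega
  | succ k ih =>
    have := ih (m / p) (Nat.div_lt_of_lt_mul (by rwa [← pow_succ']))
    rw [Fin.sum_univ_succ]
    simp only [Fin.val_zero, pow_zero, mul_one, Nat.div_one, Fin.val_succ, pow_succ, ← mul_assoc,
      ← Finset.sum_mul]
    simp only [Nat.div_div_eq_div_mul, ← pow_succ'] at this
    simp only [← pow_succ, this]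
    rw [mul_comm]
    exact Nat.mod_add_div m p

theorem pow_div_two_eq_sum {p : ℕ} (hp : Odd p) (k : ℕ) :
    p ^ k / 2 = ∑ i : Fin k, p / 2 * p ^ (i : ℕ) := by
  induction k with
  | zero => simp
  | succ k ih =>
    rw [Fin.sum_univ_castSucc]
    simp only [Fin.val_castSucc, Fin.val_last]
    rw [← ih]
    obtain ⟨a, ha⟩ := hp.pow (n := k)
    obtain ⟨b, rfl⟩ := hp
    have h1 : (2 * b + 1) / 2 = b := by omega
    have h2 : (2 * b + 1) ^ k / 2 = a := by omega
    rw [h1, h2, pow_succ, ha]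
    have : (2 * a + 1) * (2 * b + 1) = 2 * (a + b * (2 * a + 1)) + 1 := by ring
    omega

theorem prime_dvd_choose_iff_of_lt {p n a : ℕ} (hp : p.Prime) (hn : n < p) :
    p ∣ n.choose a ↔ n < a := by
  constructor
  · intro h
    by_contra! hle
    have h1 : p ∣ n.factorial := by
      rw [← Nat.choose_mul_factorial_mul_factorial hle, mul_assoc]
      exact h.mul_right _
    exact absurd ((hp.dvd_factorial).mp h1) hn.not_ge
  · intro h
    rw [Nat.choose_eq_zero_of_lt h]
    exact dvd_zero p

theorem not_dvd_choose_half_iff {p k j : ℕ} (hp : p.Prime) (hodd : Odd p) (hj : j < p ^ k) :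
    ¬ p ∣ (p ^ k / 2).choose j ↔ ∀ i : Fin k, j / p ^ (i : ℕ) % p ≤ p / 2 := by
  have := Fact.mk hp
  have hhalf : p / 2 < p := Nat.div_lt_self hp.pos one_lt_two
  have hn : p ^ k / 2 < p ^ k := Nat.div_lt_self (pow_pos hp.pos k) one_lt_two
  rw [(Choose.choose_modEq_prod_range_choose_nat hn hj).dvd_iff dvd_rfl,
    hp.prime.dvd_finsetProd_iff]
  simp only [Finset.mem_range, not_exists, not_and]
  rw [Fin.forall_iff]
  refine forall₂_congr fun i hi => ?_
  have h := sum_digit_mul_pow_div_mod k (fun _ => p / 2) (fun _ => hhalf) ⟨i, hi⟩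
  rw [← pow_div_two_eq_sum hodd] at h
  simp only at h
  rw [h, prime_dvd_choose_iff_of_lt hp hhalf, not_lt]

/-- Multiplying by `p ^ s` modulo `p ^ k - 1` rotates base-`p` digits. -/
theorem pow_mul_sum_rotate {R : Type*} [CommSemiring R] {k : ℕ} [NeZero k] {x : R}
    (hx : x ^ k = 1) (d : Fin k → ℕ) (s : Fin k) :
    x ^ (s : ℕ) * ∑ i : Fin k, (d i : R) * x ^ (i : ℕ) =
      ∑ i : Fin k, (d (i - s) : R) * x ^ (i : ℕ) := by
  rw [← Equiv.sum_comp (Equiv.addRight s) fun i => (d (i - s) : R) * x ^ (i : ℕ), Finset.mul_sum]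
  refine Finset.sum_congr rfl fun i _ => ?_
  rw [Equiv.coe_addRight, add_sub_cancel_right, Fin.val_add, ← pow_eq_pow_mod _ hx, pow_add]
  ring

/-- If multiplication by `m` modulo `q - 1` preserves the residues whose base-`p` digits are all
at most `(p - 1) / 2`, then it does not produce larger digits from them. -/
theorem digit_le_of_natCast_mul_eq {p k m : ℕ} (hm : m.Coprime (p ^ k - 1))
    (hstable : ∀ j < p ^ k, (∀ i : Fin k, j / p ^ (i : ℕ) % p ≤ p / 2) →
      ∀ i : Fin k, (m * j % (p ^ k - 1)) / p ^ (i : ℕ) % p ≤ p / 2)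
    {j : ℕ} (hj0 : 0 < j) (hj : j < p ^ k - 1)
    (hjd : ∀ i : Fin k, j / p ^ (i : ℕ) % p ≤ p / 2)
    (d : Fin k → ℕ) (hd : ∀ i, d i < p)
    (h : ((m * j : ℕ) : ZMod (p ^ k - 1)) =
      ((∑ i, d i * p ^ (i : ℕ) : ℕ) : ZMod (p ^ k - 1))) (i : Fin k) : d i ≤ p / 2 := by
  have hlt := sum_digit_mul_pow_lt k d hd
  have hst := hstable j (by omega) hjd i
  rw [ZMod.natCast_eq_natCast_iff'] at h
  have hne : ∑ i, d i * p ^ (i : ℕ) ≠ p ^ k - 1 := by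
    intro hN
    rw [hN, Nat.mod_self] at h
    have := hm.symm.dvd_of_dvd_mul_left (Nat.dvd_of_mod_eq_zero h)
    exact absurd (Nat.le_of_dvd hj0 this) hj.not_ge
  have hN : ∑ i, d i * p ^ (i : ℕ) < p ^ k - 1 := by omega
  rw [h, Nat.mod_eq_of_lt hN, sum_digit_mul_pow_div_mod k d hd] at hst
  exact hst

theorem eq_pow_of_digit_stable {p k m : ℕ} (hp : p.Prime) (hodd : Odd p) (hk : 0 < k)
    (hm : m.Coprime (p ^ k - 1)) (hmlt : m < p ^ k - 1)
    (hstable : ∀ j < p ^ k, (∀ i : Fin k, j / p ^ (i : ℕ) % p ≤ p / 2) →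
      ∀ i : Fin k, (m * j % (p ^ k - 1)) / p ^ (i : ℕ) % p ≤ p / 2) :
    ∃ l < k, m = p ^ l := by
  have : NeZero k := ⟨hk.ne'⟩
  obtain ⟨h, rfl⟩ := hodd
  have hh : (2 * h + 1) / 2 = h := by omega
  set p := 2 * h + 1 with hpdef
  have hh1 : 1 ≤ h := by
    have := hp.two_le; omega
  have hple : p ≤ p ^ k := Nat.le_self_pow hk.ne' p
  set a : Fin k → ℕ := fun i => m / p ^ (i : ℕ) % p with ha
  have hma : ∑ i, a i * p ^ (i : ℕ) = m := sum_div_mod_mul_pow k m (by omega)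
  have hpk : (p : ZMod (p ^ k - 1)) ^ k = 1 := by
    have : ((p ^ k - 1 + 1 : ℕ) : ZMod (p ^ k - 1)) = 1 := by simp
    rwa [Nat.sub_add_cancel (by omega), Nat.cast_pow] at this
  have hsmall : ∀ c ≤ h, ∀ i : Fin k, c / p ^ (i : ℕ) % p ≤ p / 2 := by
    intro c hc i
    rw [hh]
    exact (Nat.mod_le _ _).trans ((Nat.div_le_self _ _).trans hc)
  have hah : ∀ i, a i ≤ h := by
    refine fun i => hh ▸ digit_le_of_natCast_mul_eq hm hstable one_pos (by omega)
      (hsmall 1 hh1) a (fun i => Nat.mod_lt _ hp.pos) ?_ i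
    rw [hma, mul_one]
  have ha1 : ∀ i, a i ≤ 1 := by
    obtain ⟨i, hi⟩ := Finite.exists_max a
    by_contra! hcon
    obtain ⟨i', hi'⟩ := hcon
    have h2 : 2 ≤ a i := hi'.trans_le (hi i')
    have hiq := hah i
    have hc1 : h / a i + 1 ≤ h := by
      have : h / a i ≤ h / 2 := Nat.div_le_div_left h2 two_pos
      omega
    have hc2 : h < (h / a i + 1) * a i := by
      rw [mul_comm]; exact Nat.lt_mul_div_succ h (by omega)
    have hc3 : (h / a i + 1) * a i ≤ h + a i := by
      rw [add_mul, one_mul]; exact Nat.add_le_add_right (Nat.div_mul_le_self _ _) _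
    have := digit_le_of_natCast_mul_eq hm hstable (j := h / a i + 1) (Nat.succ_pos _) (by omega)
      (hsmall _ hc1) (fun r => (h / a i + 1) * a r) ?_ ?_ i
    · rw [hh] at this
      exact absurd this hc2.not_ge
    · intro r
      have := Nat.mul_le_mul_left (h / a i + 1) (hi r)
      omega
    · simp only [mul_assoc, ← Finset.mul_sum, hma]
      rw [mul_comm]
  have huniq : ∀ i i', a i = 1 → a i' = 1 → i = i' := by
    intro i i' hi hi'
    by_contra hne
    have hs : i' - i ≠ 0 := sub_ne_zero.mpr (Ne.symm hne)
    set s := i' - i with hs_def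
    let e : Fin k → ℕ := fun r => (if r = s then h else 0) + (if r = 0 then 1 else 0)
    have heh : ∀ r, e r ≤ h := by
      intro r
      simp only [e]
      by_cases hr : r = s
      · simp [hr, hs]
      · simp only [hr, if_false]; split_ifs <;> omega
    have hesum : ∑ r, e r * p ^ (r : ℕ) = h * p ^ (s : ℕ) + 1 := by
      simp [e, add_mul, Finset.sum_add_distrib]
    have hjle : h * p ^ (s : ℕ) + 1 ≤ p ^ k / 2 := by
      rw [← hesum, pow_div_two_eq_sum ⟨h, rfl⟩, hh]
      exact Finset.sum_le_sum fun r _ => Nat.mul_le_mul_right _ (heh r)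
    have := digit_le_of_natCast_mul_eq hm hstable (j := h * p ^ (s : ℕ) + 1) (by omega)
      (by omega) ?_ (fun r => h * a (r - s) + a r) ?_ ?_ i'
    · have hsub : i' - s = i := by rw [hs_def]; abel
      rw [hh, hsub, hi, hi'] at this
      omega
    · intro r
      rw [← hesum, sum_digit_mul_pow_div_mod k e (fun r => by have := heh r; omega), hh]
      exact heh r
    · intro r
      have h1 := Nat.mul_le_mul_left h (ha1 (r - s))
      have h2 := ha1 r
      omega
    · have hrot := pow_mul_sum_rotate hpk a s
      have hma' : ∑ i : Fin k, (a i : ZMod (p ^ k - 1)) * (p : ZMod (p ^ k - 1)) ^ (i : ℕ) = m := by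
        exact_mod_cast congrArg (Nat.cast (R := ZMod (p ^ k - 1))) hma
      push_cast
      simp only [add_mul, Finset.sum_add_distrib, mul_assoc, ← Finset.mul_sum]
      rw [← hrot, hma']
      ring
  have hm0 : m ≠ 0 := by
    rintro rfl
    rw [Nat.coprime_zero_left] at hm
    omega
  obtain ⟨i, hi⟩ : ∃ i, a i ≠ 0 := by
    by_contra! hcon
    exact hm0 (by rw [← hma]; simp [hcon])
  have hi1 : a i = 1 := by have := ha1 i; omega
  refine ⟨i, i.isLt, ?_⟩
  rw [← hma, Finset.sum_eq_single i, hi1, one_mul]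
  · intro r _ hr
    have : a r ≠ 1 := fun h => hr (huniq r i h hi1)
    have h1 := ha1 r
    have : a r = 0 := by omega
    rw [this, zero_mul]
  · simp

theorem not_dvd_choose_mul_mod {F : Type*} [Field F] [Fintype F] {p n m : ℕ} [CharP F p]
    (hn : n < Fintype.card F - 1) (hm : m.Coprime (Fintype.card F - 1))
    (h : ∀ x : F, x ≠ 0 → (x ^ m - 1) ^ n = (x - 1) ^ n) {j : ℕ} (hj : ¬ p ∣ n.choose j) :
    ¬ p ∣ n.choose (m * j % (Fintype.card F - 1)) := by
  classical
  set N := Fintype.card F - 1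
  let P : Polynomial F := ∑ i ∈ Finset.range (n + 1),
    Polynomial.monomial (m * i % N) ((-1) ^ (n - i) * (n.choose i : F))
  have hPQ : P = (Polynomial.X + Polynomial.C (-1)) ^ n := by
    refine Polynomial.eq_of_natDegree_lt_card_of_eval_eq' _ _ (Finset.univ.erase (0 : F)) ?_ ?_
    · intro x hx
      have hx0 : x ≠ 0 := Finset.ne_of_mem_erase hx
      have hx1 : x ^ N = 1 := FiniteField.pow_card_sub_one_eq_one x hx0
      have := h x hx0
      simp only [P, Polynomial.eval_finsetSum, Polynomial.eval_monomial, ← pow_eq_pow_mod _ hx1,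
        Polynomial.eval_pow, Polynomial.eval_add, Polynomial.eval_X, Polynomial.eval_C]
      rw [← sub_eq_add_neg, ← this, sub_eq_add_neg, add_pow]
      refine Finset.sum_congr rfl fun i _ => ?_
      rw [pow_mul]
      ring
    · rw [Finset.card_erase_of_mem (Finset.mem_univ _), Finset.card_univ]
      refine max_lt (Nat.lt_of_le_pred (by omega) ?_) ?_
      · refine Polynomial.natDegree_sum_le_of_forall_le _ _ fun i _ => ?_
        refine (Polynomial.natDegree_monomial_le _).trans (Nat.le_pred_of_lt ?_)
        exact Nat.mod_lt _ (by omega)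
      · rwa [Polynomial.natDegree_pow, Polynomial.natDegree_X_add_C, mul_one]
  have hjn : j ≤ n := by
    by_contra! hlt
    exact hj (by simp [Nat.choose_eq_zero_of_lt hlt])
  have hcoeff : P.coeff (m * j % N) = (-1) ^ (n - j) * (n.choose j : F) := by
    simp only [P, Polynomial.finsetSum_coeff, Polynomial.coeff_monomial]
    rw [Finset.sum_eq_single j]
    · simp
    · intro i hi hij
      rw [if_neg]
      intro heq
      have hmod : i % N = j % N := Nat.ModEq.cancel_left_of_coprime hm.symm heq
      rw [Finset.mem_range] at hi
      rw [Nat.mod_eq_of_lt (by omega), Nat.mod_eq_of_lt (by omega)] at hmod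
      exact hij hmod
    · intro hj'
      exact absurd (Finset.mem_range.mpr (by omega)) hj'
  intro hdvd
  rw [hPQ, Polynomial.coeff_X_add_C_pow, (CharP.cast_eq_zero_iff F p _).mpr hdvd,
    mul_zero] at hcoeff
  refine hj ((CharP.cast_eq_zero_iff F p _).mp ?_)
  simpa using hcoeff.symm

/-- An injective multiplicative endomorphism of a finite field is a power map with exponent
prime to the order of the unit group. -/
theorem exists_coprime_pow_of_injective {F : Type*} [Field F] [Fintype F] (g : F →* F)
    (hg : Function.Injective g) (hF : 2 < Fintype.card F) :
    ∃ m, m < Fintype.card F - 1 ∧ m.Coprime (Fintype.card F - 1) ∧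
      ∀ x : F, x ≠ 0 → g x = x ^ m := by
  obtain ⟨ζ, hζ⟩ := IsCyclic.exists_generator (α := Fˣ)
  have hord : orderOf ζ = Fintype.card F - 1 := by
    rw [orderOf_eq_card_of_forall_mem_zpowers hζ, Nat.card_units, Nat.card_eq_fintype_card]
  have hpow : ∀ x : Fˣ, ∃ t : ℕ, ζ ^ t = x := fun x =>
    (mem_powers_iff_mem_zpowers.mpr (hζ x))
  obtain ⟨t, ht⟩ := hpow (Units.map g ζ)
  have hinj : Function.Injective (Units.map g) := Units.map_injective hg
  have hmt : ζ ^ (t % (Fintype.card F - 1)) = Units.map g ζ := by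
    rw [← hord, pow_mod_orderOf, ht]
  refine ⟨t % (Fintype.card F - 1), Nat.mod_lt _ (by omega), ?_, ?_⟩
  · have h1 := orderOf_injective (Units.map g) hinj ζ
    rw [← hmt, orderOf_pow, hord, Nat.div_eq_self] at h1
    rcases h1 with h1 | h1
    · omega
    · rw [Nat.Coprime, Nat.gcd_comm, h1]
  · intro x hx
    obtain ⟨s, hs⟩ := hpow (Units.mk0 x hx)
    have h1 : Units.map g (Units.mk0 x hx) =
        Units.mk0 x hx ^ (t % (Fintype.card F - 1)) := by
      rw [← hs, map_pow, ← hmt, pow_right_comm]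
    simpa using congrArg Units.val h1

/-- A multiplicative injection of a finite field of order `q ≡ 3 (mod 4)` that preserves the
quadratic character of `x - 1` is a power of the Frobenius. -/
theorem exists_eq_frobenius_pow {F : Type*} [Field F] [Fintype F] {p k : ℕ} (hp : p.Prime)
    (hcard : Fintype.card F = p ^ k) (hq : Fintype.card F % 4 = 3) (g : F →* F)
    (hg : Function.Injective g) (h0 : g 0 = 0)
    (h1 : ∀ x, IsPos (x - 1) → IsPos (g x - 1)) (h2 : ∀ x, IsPos (1 - x) → IsPos (1 - g x)) :
    ∃ l < k, ∀ x, g x = x ^ p ^ l := by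
  have := Fact.mk hp
  have := charP_of_card_eq_prime_pow hcard
  have hk : 0 < k := by
    rcases Nat.eq_zero_or_pos k with rfl | hk
    · rw [hcard] at hq; simp at hq
    · exact hk
  have hodd : Odd p := by
    by_contra hne
    rw [Nat.not_odd_iff_even] at hne
    have := hne.pow_of_ne_zero hk.ne'
    rw [← hcard, Nat.even_iff] at this
    omega
  obtain ⟨m, hmlt, hm, hgm⟩ := exists_coprime_pow_of_injective g hg (by omega)
  have hpos : ∀ y : F, IsPos y → y ^ (Fintype.card F / 2) = 1 := by
    rintro _ ⟨z, hz, rfl⟩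
    rw [← pow_mul, show 2 * (Fintype.card F / 2) = Fintype.card F - 1 by omega]
    exact FiniteField.pow_card_sub_one_eq_one z hz
  have hoddn : Odd (Fintype.card F / 2) := by
    rw [Nat.odd_iff]; omega
  have hid : ∀ x : F, x ≠ 0 →
      (x ^ m - 1) ^ (Fintype.card F / 2) = (x - 1) ^ (Fintype.card F / 2) := by
    intro x hx
    rw [← hgm x hx]
    by_cases hx1 : x = 1
    · simp [hx1]
    rcases isPos_or_isPos_neg hq (sub_ne_zero.mpr hx1) with h | h
    · rw [hpos _ h, hpos _ (h1 x h)]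
    · rw [neg_sub] at h
      rw [← neg_sub 1 x, ← neg_sub 1 (g x), hoddn.neg_pow, hoddn.neg_pow, hpos _ h,
        hpos _ (h2 x h)]
  obtain ⟨l, hl, rfl⟩ := eq_pow_of_digit_stable hp hodd hk (hcard ▸ hm) (hcard ▸ hmlt) (by
    intro j hj hjd
    rw [← not_dvd_choose_half_iff hp hodd hj] at hjd
    have hlt : m * j % (p ^ k - 1) < p ^ k :=
      (Nat.mod_lt _ (by omega)).trans_le (Nat.sub_le _ _)
    rw [← not_dvd_choose_half_iff hp hodd hlt]
    rw [← hcard] at hjd ⊢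
    exact not_dvd_choose_mul_mod (by omega) hm hid hjd)
  refine ⟨l, hl, fun x => ?_⟩
  by_cases hx : x = 0
  · rw [hx, h0, zero_pow (pow_pos hp.pos l).ne']
  · exact hgm x hx

theorem preservesPos_two_of_eq_mul_frobenius_pow {F : Type*} [Field F] {p : ℕ} [Fact p.Prime]
    [CharP F p] {f : F → F} {c : F} {l : ℕ} (hc : IsPos c) (h : ∀ x, f x = c * x ^ p ^ l) :
    PreservesPos 2 f := by
  rw [preservesPos_two_iff]
  intro a b d ha hd
  rw [h, h, h]
  refine ⟨hc.mul (ha.pow _), ?_⟩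
  convert (hc.mul hc).mul (hd.pow (p ^ l)) using 1
  rw [sub_pow_char_pow, mul_pow, mul_pow]
  ring

/-- over `F = 𝔽_{p^k}` with `q ≡ 3 (mod 4)`, `f` preserves positivity on
`M_2(F)` iff `f` is a positive multiple of a field automorphism, i.e.
`f x = c x^{p^ℓ}` with `c ∈ F⁺` and `0 ≤ ℓ ≤ k − 1`. -/
theorem stmt2 {F : Type*} [Field F] [Fintype F] (p k : ℕ) (hp : p.Prime)
    (hcard : Fintype.card F = p ^ k) (hq : Fintype.card F % 4 = 3) (f : F → F) :
    PreservesPos 2 f ↔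
      ∃ (c : F) (ℓ : ℕ), IsPos c ∧ ℓ ≤ k - 1 ∧ ∀ x : F, f x = c * x ^ p ^ ℓ := by
  have := Fact.mk hp
  have := charP_of_card_eq_prime_pow hcard
  constructor
  · intro hf
    have hf1 := map_isPos_of_preserves hf (isPos_one (F := F))
    have hf1' := isPos_ne_zero hf1
    let g : F →* F :=
      { toFun := fun x => (f 1)⁻¹ * f x
        map_one' := inv_mul_cancel₀ hf1'
        map_mul' := fun x y => by
          have := map_mul_of_preserves hq hf x y
          field_simp
          linear_combination this }
    have hgf : ∀ x, g x = (f 1)⁻¹ * f x := fun _ => rfl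
    obtain ⟨l, hl, hgl⟩ := exists_eq_frobenius_pow hp hcard hq g
      (fun x y hxy => injective_of_preserves hq hf (mul_left_cancel₀ (inv_ne_zero hf1') hxy))
      (by rw [hgf, map_zero_of_preserves hq hf, mul_zero])
      (fun x hx => by
        have := hf1.inv.mul (map_sub_isPos_of_preserves hf isPos_one hx)
        rwa [mul_sub, inv_mul_cancel₀ hf1'] at this)
      (fun x hx => by
        have := hf1.inv.mul (map_one_sub_map_isPos_of_preserves hq hf hx)
        rwa [mul_sub, inv_mul_cancel₀ hf1'] at this)
    refine ⟨f 1, l, hf1, by omega, fun x => ?_⟩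
    rw [← hgl, hgf, mul_inv_cancel_left₀ hf1']
  · rintro ⟨c, l, hc, -, h⟩
    exact preservesPos_two_of_eq_mul_frobenius_pow hc h
end

section
/- Let q = p^k be a prime power with q ≡ 3 (mod 4). If f : F_q → F_q preserves positivity on M_2(F_q) and f(1) = 1, then there exists an integer ℓ with 0 ≤ ℓ ≤ k−1 such that f(x) = x^{p^ℓ} for all x ∈ F_q. -/
theorem isPos_iff_pow {F : Type*} [Field F] [Fintype F] (hq : Fintype.card F % 4 = 3) (x : F) :
    IsPos x ↔ x ^ (Fintype.card F / 2) = 1 := by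
  have hF : ringChar F ≠ 2 := by
    intro h
    have := FiniteField.even_card_iff_char_two.1 h
    omega
  have hm : Fintype.card F / 2 ≠ 0 := by omega
  by_cases hx : x = 0
  · subst hx
    rw [zero_pow hm]
    constructor
    · rintro ⟨y, hy, h⟩
      exact absurd h (pow_ne_zero 2 hy)
    · intro h
      exact absurd h zero_ne_one
  · rw [← FiniteField.isSquare_iff hF hx]
    constructor
    · rintro ⟨y, -, rfl⟩
      exact IsSquare.sq y
    · rintro ⟨y, rfl⟩
      exact ⟨y, by rintro rfl; simp at hx, sq y⟩

theorem IsPos.ne_zero {F : Type*} [Field F] {x : F} (hx : IsPos x) : x ≠ 0 := by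
  obtain ⟨y, hy, rfl⟩ := hx
  exact pow_ne_zero 2 hy

theorem isPos_sq {F : Type*} [Field F] {x : F} (hx : x ≠ 0) : IsPos (x ^ 2) := ⟨x, hx, rfl⟩

theorem IsPos.of_mul {F : Type*} [Field F] {x y : F} (hx : IsPos x) (hxy : IsPos (x * y)) :
    IsPos y := by
  simpa [hx.ne_zero] using hx.inv.mul hxy

theorem odd_card_half {F : Type*} [Fintype F] (hq : Fintype.card F % 4 = 3) :
    Odd (Fintype.card F / 2) := by
  rw [Nat.odd_iff]
  omega

theorem isPos_trichotomy {F : Type*} [Field F] [Fintype F] (hq : Fintype.card F % 4 = 3) (x : F) :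
    x = 0 ∨ IsPos x ∨ IsPos (-x) := by
  have hF : ringChar F ≠ 2 := by
    intro h
    have := FiniteField.even_card_iff_char_two.1 h
    omega
  by_cases hx : x = 0
  · exact Or.inl hx
  · rw [isPos_iff_pow hq, isPos_iff_pow hq, (odd_card_half hq).neg_pow]
    rcases FiniteField.pow_dichotomy hF hx with h | h
    · exact Or.inr (Or.inl h)
    · exact Or.inr (Or.inr (by rw [h, neg_neg]))

theorem eq_of_forall_isPos_sub_s3 {F : Type*} [Field F] [Fintype F] (hq : Fintype.card F % 4 = 3)
    {x y : F} (hx : IsPos x) (hy : IsPos y)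
    (h : ∀ c, IsPos c → IsPos (c - x) → IsPos (c - y)) : x = y := by
  classical
  let A : F → Finset F := fun z => Finset.univ.filter fun c => IsPos c ∧ IsPos (c - z)
  have hA : ∀ z c, c ∈ A z ↔ IsPos c ∧ IsPos (c - z) := by simp [A]
  have hsub : A x ⊆ A y := by
    intro c hc
    rw [hA] at hc ⊢
    exact ⟨hc.1, h c hc.1 hc.2⟩
  have hcard : (A y).card ≤ (A x).card := by
    refine Finset.card_le_card_of_injOn (fun c => x * y⁻¹ * c) ?_ ?_
    · intro c hc
      have hc' := (hA y c).1 hc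
      refine (hA x _).2 ⟨(hx.mul hy.inv).mul hc'.1, ?_⟩
      have e : x * y⁻¹ * c - x = x * y⁻¹ * (c - y) := by
        have := hy.ne_zero
        field_simp
      rw [e]
      exact (hx.mul hy.inv).mul hc'.2
    · intro a _ b _ hab
      exact mul_left_cancel₀ (mul_ne_zero hx.ne_zero (inv_ne_zero hy.ne_zero)) hab
  have heq := Finset.eq_of_subset_of_card_le hsub hcard
  have hno : ∀ z : F, ¬ IsPos (z - z) := fun z hz => hz.ne_zero (sub_self z)
  rcases isPos_trichotomy hq (x - y) with h0 | h0 | h0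
  · exact sub_eq_zero.1 h0
  · have : x ∈ A x := by
      rw [heq, hA]
      exact ⟨hx, h0⟩
    exact absurd ((hA _ _).1 this).2 (hno x)
  · rw [neg_sub] at h0
    have : y ∈ A y := by
      rw [← heq, hA]
      exact ⟨hy, h0⟩
    exact absurd ((hA _ _).1 this).2 (hno y)

theorem eq_of_forall_isPos_sub' {F : Type*} [Field F] [Fintype F] (hq : Fintype.card F % 4 = 3)
    {x y : F} (hx : IsPos x) (hy : IsPos y)
    (h : ∀ d, IsPos d → IsPos (x - d) → IsPos (y - d)) : x = y := by
  have key : ∀ {z c : F}, IsPos z → IsPos c → z - c⁻¹ = z * c⁻¹ * (c - z⁻¹) := by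
    intro z c hz hc
    have := hz.ne_zero
    have := hc.ne_zero
    field_simp
  refine inv_injective (eq_of_forall_isPos_sub_s3 hq hx.inv hy.inv fun c hc hcx => ?_)
  have := h c⁻¹ hc.inv (by rw [key hx hc]; exact (hx.mul hc.inv).mul hcx)
  rw [key hy hc] at this
  exact (hy.mul hc.inv).of_mul this

theorem exists_isPos_neg_add {F : Type*} [Field F] [Fintype F] (hq : Fintype.card F % 4 = 3) :
    ∃ u v : F, IsPos u ∧ IsPos v ∧ IsPos (-(u + v)) := by
  by_contra! hcon
  have hadd : ∀ u v : F, IsPos u → IsPos v → IsPos (u + v) := by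
    intro u v hu hv
    rcases isPos_trichotomy hq (u + v) with h | h | h
    · rw [eq_neg_of_add_eq_zero_left h] at hu
      exact absurd hu (hv.not_neg hq)
    · exact h
    · exact absurd h (hcon u v hu hv)
  have hnat : ∀ n : ℕ, IsPos ((n + 1 : ℕ) : F) := by
    intro n
    induction n with
    | zero => simpa using isPos_one
    | succ n ih =>
      rw [Nat.cast_succ]
      exact hadd _ _ ih isPos_one
  have h := hnat (Fintype.card F - 1)
  rw [Nat.sub_add_cancel Fintype.card_pos] at h
  exact h.ne_zero (FiniteField.cast_card_eq_zero F)

theorem isPosDef_two_iff {F : Type*} [Field F] (a b c : F) :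
    IsPosDef !![a, b; b, c] ↔ IsPos a ∧ IsPos (a * c - b ^ 2) := by
  have hs : (!![a, b; b, c] : Matrix (Fin 2) (Fin 2) F).IsSymm := by
    ext i j
    fin_cases i <;> fin_cases j <;> rfl
  have h0 : leadingMinor !![a, b; b, c] 0 = a := by
    simp [leadingMinor, Matrix.det_unique]
  have h1 : leadingMinor !![a, b; b, c] 1 = a * c - b ^ 2 := by
    have : leadingMinor !![a, b; b, c] 1 = (!![a, b; b, c] : Matrix (Fin 2) (Fin 2) F).det := rfl
    rw [this, Matrix.det_fin_two_of, sq]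
  simp only [IsPosDef, hs, true_and, Fin.forall_fin_two, h0, h1]

theorem PreservesPos.apply_two {F : Type*} [Field F] {f : F → F} (hf : PreservesPos 2 f)
    {a b c : F} (ha : IsPos a) (h : IsPos (a * c - b ^ 2)) :
    IsPos (f a) ∧ IsPos (f a * f c - f b ^ 2) := by
  have e : entrywiseMap f !![a, b; b, c] = !![f a, f b; f b, f c] := by
    ext i j
    fin_cases i <;> fin_cases j <;> rfl
  have := hf _ ((isPosDef_two_iff a b c).2 ⟨ha, h⟩)
  rwa [e, isPosDef_two_iff] at this

section Preserver

variable {F : Type*} [Field F] {f : F → F}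

theorem PreservesPos.isPos_apply (hf : PreservesPos 2 f) {a : F} (ha : IsPos a) :
    IsPos (f a) :=
  (hf.apply_two (b := 0) (c := a) ha (by simpa using ha.mul ha)).1

theorem PreservesPos.isPos_sub (hf : PreservesPos 2 f) {a b : F} (ha : IsPos a) (hb : IsPos b)
    (h : IsPos (a - b)) : IsPos (f a - f b) := by
  have h1 := (hf.apply_two (a := a) (b := b) (c := b) ha (by
    have : a * b - b ^ 2 = b * (a - b) := by ring
    rw [this]
    exact hb.mul h)).2
  have e : f a * f b - f b ^ 2 = f b * (f a - f b) := by ring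
  rw [e] at h1
  exact (hf.isPos_apply hb).of_mul h1

variable [Fintype F]

theorem PreservesPos.eq_of_apply_eq (hf : PreservesPos 2 f) (hq : Fintype.card F % 4 = 3)
    {a b : F} (ha : IsPos a) (hb : IsPos b) (h : f a = f b) : a = b := by
  rcases isPos_trichotomy hq (a - b) with h0 | h0 | h0
  · exact sub_eq_zero.1 h0
  · exact absurd (sub_eq_zero.2 h) (hf.isPos_sub ha hb h0).ne_zero
  · rw [neg_sub] at h0
    exact absurd (sub_eq_zero.2 h.symm) (hf.isPos_sub hb ha h0).ne_zero

theorem PreservesPos.exists_apply_eq (hf : PreservesPos 2 f) (hq : Fintype.card F % 4 = 3)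
    {y : F} (hy : IsPos y) : ∃ x, IsPos x ∧ f x = y := by
  let g : {x : F // IsPos x} → {x : F // IsPos x} := fun x => ⟨f x, hf.isPos_apply x.2⟩
  have hg : Function.Injective g := fun a b hab =>
    Subtype.ext (hf.eq_of_apply_eq hq a.2 b.2 (congrArg Subtype.val hab))
  obtain ⟨x, hx⟩ := Finite.surjective_of_injective hg ⟨y, hy⟩
  exact ⟨x, x.2, congrArg Subtype.val hx⟩

theorem PreservesPos.isPos_of_isPos_sub (hf : PreservesPos 2 f) (hq : Fintype.card F % 4 = 3)
    {a b : F} (ha : IsPos a) (hb : IsPos b) (h : IsPos (f a - f b)) : IsPos (a - b) := by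
  rcases isPos_trichotomy hq (a - b) with h0 | h0 | h0
  · rw [sub_eq_zero.1 h0] at h
    exact absurd (sub_self _) h.ne_zero
  · exact h0
  · rw [neg_sub] at h0
    have := hf.isPos_sub hb ha h0
    rw [← neg_sub] at this
    exact absurd this (h.not_neg hq)

theorem PreservesPos.map_zero (hf : PreservesPos 2 f) (hq : Fintype.card F % 4 = 3)
    (hf1 : f 1 = 1) : f 0 = 0 := by
  by_contra h
  obtain ⟨c, hc, hfc⟩ := hf.exists_apply_eq hq (isPos_sq h)
  have := (hf.apply_two (a := 1) (b := 0) (c := c) isPos_one (by simpa using hc)).2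
  rw [hf1, one_mul, hfc, sub_self] at this
  exact this.ne_zero rfl

theorem PreservesPos.apply_ne_zero (hf : PreservesPos 2 f) (hq : Fintype.card F % 4 = 3)
    {b : F} (hb : b ≠ 0) : f b ≠ 0 := by
  intro h
  rcases isPos_trichotomy hq b with h0 | h0 | h0
  · exact hb h0
  · exact (hf.isPos_apply h0).ne_zero h
  · obtain ⟨u, v, hu, hv, huv⟩ := exists_isPos_neg_add (F := F) hq
    have := (hf.apply_two (a := u * -b * v⁻¹) (b := b) (c := b) ((hu.mul h0).mul hv.inv) (by
      have hv0 := hv.ne_zero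
      have e : u * -b * v⁻¹ * b - b ^ 2 = b ^ 2 * v⁻¹ * -(u + v) := by
        field_simp
        ring
      rw [e]
      exact ((isPos_sq hb).mul hv.inv).mul huv)).2
    rw [h] at this
    exact this.ne_zero (by ring)

theorem PreservesPos.map_sq (hf : PreservesPos 2 f) (hq : Fintype.card F % 4 = 3)
    (hf1 : f 1 = 1) {b : F} (hb : b ≠ 0) : f (b ^ 2) = f b ^ 2 := by
  obtain ⟨e, he, hfe⟩ := hf.exists_apply_eq hq (isPos_sq (hf.apply_ne_zero hq hb))
  rw [← hfe]
  congr 1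
  refine eq_of_forall_isPos_sub_s3 hq (isPos_sq hb) he fun c hc hcb => ?_
  have := (hf.apply_two (a := 1) (b := b) (c := c) isPos_one (by rwa [one_mul])).2
  rw [hf1, one_mul, ← hfe] at this
  exact hf.isPos_of_isPos_sub hq hc he this

theorem PreservesPos.map_mul_of_isPos (hf : PreservesPos 2 f) (hq : Fintype.card F % 4 = 3)
    (hf1 : f 1 = 1) {a c : F} (ha : IsPos a) (hc : IsPos c) : f (a * c) = f a * f c := by
  obtain ⟨g, hg, hfg⟩ := hf.exists_apply_eq hq ((hf.isPos_apply ha).mul (hf.isPos_apply hc))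
  rw [← hfg]
  congr 1
  refine eq_of_forall_isPos_sub' hq (ha.mul hc) hg fun d hd hcd => ?_
  obtain ⟨b, hb, rfl⟩ := id hd
  have := (hf.apply_two ha hcd).2
  rw [← hf.map_sq hq hf1 hb, ← hfg] at this
  exact hf.isPos_of_isPos_sub hq hg hd this

theorem PreservesPos.map_neg_of_isPos (hf : PreservesPos 2 f) (hq : Fintype.card F % 4 = 3)
    (hf1 : f 1 = 1) {c : F} (hc : IsPos c) : f (-c) = -f c := by
  have h1 : f (-c) ^ 2 = f c ^ 2 := by
    rw [← hf.map_sq hq hf1 hc.ne_zero, ← hf.map_sq hq hf1 (neg_ne_zero.2 hc.ne_zero), neg_sq]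
  rcases sq_eq_sq_iff_eq_or_eq_neg.1 h1 with h | h
  · exfalso
    have key : ∀ u v : F, IsPos u → IsPos v → IsPos (-(u + v)) → IsPos (u - v) := by
      intro u v hu hv huv
      obtain ⟨b, hb, rfl⟩ := id hv
      have hc0 := hc.ne_zero
      have := (hf.apply_two (a := u * c⁻¹) (b := b) (c := -c) (hu.mul hc.inv) (by
        have e : u * c⁻¹ * -c - b ^ 2 = -(u + b ^ 2) := by
          field_simp
          ring
        rwa [e])).2
      rw [h, ← hf.map_mul_of_isPos hq hf1 (hu.mul hc.inv) hc, ← hf.map_sq hq hf1 hb,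
        inv_mul_cancel_right₀ hc0] at this
      exact hf.isPos_of_isPos_sub hq hu hv this
    obtain ⟨u, v, hu, hv, huv⟩ := exists_isPos_neg_add (F := F) hq
    have h2 := key u v hu hv huv
    have h3 := key v u hv hu (by rwa [add_comm])
    rw [← neg_sub] at h3
    exact h2.not_neg hq h3
  · exact h

theorem PreservesPos.map_neg (hf : PreservesPos 2 f) (hq : Fintype.card F % 4 = 3)
    (hf1 : f 1 = 1) (x : F) : f (-x) = -f x := by
  rcases isPos_trichotomy hq x with rfl | h | h
  · simp [hf.map_zero hq hf1]
  · exact hf.map_neg_of_isPos hq hf1 h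
  · rw [← neg_neg x, hf.map_neg_of_isPos hq hf1 h, neg_neg, neg_neg]

theorem PreservesPos.map_mul (hf : PreservesPos 2 f) (hq : Fintype.card F % 4 = 3)
    (hf1 : f 1 = 1) (x y : F) : f (x * y) = f x * f y := by
  have hneg := hf.map_neg hq hf1
  have h0 := hf.map_zero hq hf1
  have hpos : ∀ x y : F, IsPos x → f (x * y) = f x * f y := by
    intro x y hx
    rcases isPos_trichotomy hq y with rfl | h | h
    · simp [h0]
    · exact hf.map_mul_of_isPos hq hf1 hx h
    · have := hf.map_mul_of_isPos hq hf1 hx h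
      rw [mul_neg, hneg, hneg, mul_neg] at this
      exact neg_injective this
  rcases isPos_trichotomy hq x with rfl | h | h
  · simp [h0]
  · exact hpos x y h
  · have := hpos (-x) y h
    rw [neg_mul, hneg, hneg, neg_mul] at this
    exact neg_injective this

theorem PreservesPos.isPos_one_sub (hf : PreservesPos 2 f) (hq : Fintype.card F % 4 = 3)
    (hf1 : f 1 = 1) {a : F} (h : IsPos (1 - a)) : IsPos (1 - f a) := by
  have hmono : ∀ {a b : F}, IsPos a → IsPos b → IsPos (a - b) → IsPos (f a - f b) :=
    fun ha hb h => hf.isPos_sub ha hb h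
  rcases isPos_trichotomy hq a with rfl | ha | ha
  · simpa [hf.map_zero hq hf1] using isPos_one
  · have := hmono isPos_one ha h
    rwa [hf1] at this
  · obtain ⟨c, rfl⟩ : ∃ c, a = -c := ⟨-a, (neg_neg a).symm⟩
    rw [neg_neg] at ha
    rw [sub_neg_eq_add] at h
    rw [hf.map_neg hq hf1, sub_neg_eq_add]
    have hsq := hf.map_sq hq hf1 ha.ne_zero
    have hc2 := isPos_sq ha.ne_zero
    rcases isPos_trichotomy hq (1 - c) with hc | hc | hc
    · rw [← sub_eq_zero.1 hc] at h ⊢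
      rwa [hf1]
    · have h1 := hmono isPos_one ha hc
      have h2 := hmono isPos_one hc2 (by
        have e : 1 - c ^ 2 = (1 - c) * (1 + c) := by ring
        rw [e]
        exact hc.mul h)
      rw [hf1] at h1 h2
      have e : 1 - f (c ^ 2) = (1 - f c) * (1 + f c) := by
        rw [hsq]
        ring
      rw [e] at h2
      exact h1.of_mul h2
    · rw [neg_sub] at hc
      have h1 := hmono ha isPos_one hc
      have h2 := hmono hc2 isPos_one (by
        have e : c ^ 2 - 1 = (c - 1) * (1 + c) := by ring
        rw [e]
        exact hc.mul h)
      rw [hf1] at h1 h2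
      have e : f (c ^ 2) - 1 = (f c - 1) * (1 + f c) := by
        rw [hsq]
        ring
      rw [e] at h2
      exact h1.of_mul h2

theorem PreservesPos.sub_one_pow (hf : PreservesPos 2 f) (hq : Fintype.card F % 4 = 3)
    (hf1 : f 1 = 1) (x : F) :
    (f x - 1) ^ (Fintype.card F / 2) = (x - 1) ^ (Fintype.card F / 2) := by
  rcases isPos_trichotomy hq (x - 1) with h | h | h
  · rw [sub_eq_zero.1 h, hf1]
  · have h1 := (hf.apply_two (a := 1) (b := 1) (c := x) isPos_one (by simpa using h)).2
    rw [hf1, one_mul, one_pow] at h1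
    rw [(isPos_iff_pow hq _).1 h, (isPos_iff_pow hq _).1 h1]
  · rw [neg_sub] at h
    have h1 := hf.isPos_one_sub hq hf1 h
    rw [← neg_sub 1 x, ← neg_sub 1 (f x), (odd_card_half hq).neg_pow, (odd_card_half hq).neg_pow,
      (isPos_iff_pow hq _).1 h, (isPos_iff_pow hq _).1 h1]

end Preserver

theorem sum_units_pow_mul_sub_one_pow {F : Type*} [Field F] [Fintype F] [DecidableEq F]
    (N m : ℕ) :
    ∑ u : Fˣ, (u : F) ^ N * ((u : F) - 1) ^ m =
      ∑ i ∈ Finset.range (m + 1),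
        (-1) ^ (i + m) * (m.choose i : F) *
          (if Fintype.card F - 1 ∣ N + i then -1 else 0) := by
  simp only [← FiniteField.sum_pow_units F, Finset.mul_sum]
  rw [Finset.sum_comm]
  refine Finset.sum_congr rfl fun u _ => ?_
  rw [sub_pow, Finset.mul_sum]
  refine Finset.sum_congr rfl fun i _ => ?_
  rw [one_pow, pow_add (u : F)]
  ring

/-- If `u ↦ u ^ n` permutes the units and preserves `(u - 1) ^ m`, then multiplication by `n`
maps the support of the binomial coefficients `m.choose j` into residues at most `m`. -/
theorem exists_modEq_of_sub_one_pow_eq {F : Type*} [Field F] [Fintype F] {n m : ℕ}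
    (hm : m < Fintype.card F - 1) (hn : Function.Bijective fun u : Fˣ => u ^ n)
    (hnm : ∀ u : Fˣ, ((u : F) ^ n - 1) ^ m = ((u : F) - 1) ^ m) {j : ℕ}
    (hj : (m.choose j : F) ≠ 0) : ∃ i ≤ m, n * j ≡ i [MOD Fintype.card F - 1] := by
  classical
  have hjm : j ≤ m := by
    by_contra! h
    exact hj (by rw [Nat.choose_eq_zero_of_lt h, Nat.cast_zero])
  set Q := Fintype.card F - 1 with hQ
  have hsum : ∑ u : Fˣ, (u : F) ^ (n * (Q - j)) * ((u : F) - 1) ^ m =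
      ∑ u : Fˣ, (u : F) ^ (Q - j) * ((u : F) - 1) ^ m := by
    rw [← hn.sum_comp fun u : Fˣ => (u : F) ^ (Q - j) * ((u : F) - 1) ^ m]
    refine Finset.sum_congr rfl fun u _ => ?_
    rw [Units.val_pow_eq_pow_val, hnm, pow_mul]
  have hne : ∑ u : Fˣ, (u : F) ^ (Q - j) * ((u : F) - 1) ^ m ≠ 0 := by
    rw [sum_units_pow_mul_sub_one_pow, Finset.sum_eq_single j]
    · rw [if_pos (by rw [← hQ, Nat.sub_add_cancel (by omega)])]
      exact mul_ne_zero (mul_ne_zero (pow_ne_zero _ (neg_ne_zero.2 one_ne_zero)) hj)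
        (neg_ne_zero.2 one_ne_zero)
    · intro i hi hij
      rw [if_neg, mul_zero]
      intro hdvd
      have him : i < m + 1 := Finset.mem_range.1 hi
      refine hij (Nat.ModEq.eq_of_lt_of_lt (m := Q) ?_ (by omega) (by omega))
      refine Nat.ModEq.add_left_cancel' (Q - j) ?_
      rw [Nat.sub_add_cancel (by omega : j ≤ Q)]
      exact (Nat.modEq_zero_iff_dvd.2 hdvd).trans (Nat.modEq_zero_iff_dvd.2 dvd_rfl).symm
    · intro h
      exact absurd (Finset.mem_range.2 (by omega)) h
  rw [← hsum, sum_units_pow_mul_sub_one_pow] at hne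
  obtain ⟨i, hi, hi0⟩ := Finset.exists_ne_zero_of_sum_ne_zero hne
  refine ⟨i, by have := Finset.mem_range.1 hi; omega, ?_⟩
  have hdvd : Q ∣ n * (Q - j) + i := by
    by_contra h
    rw [if_neg h, mul_zero] at hi0
    exact hi0 rfl
  refine Nat.ModEq.add_left_cancel' (n * (Q - j)) ?_
  rw [← mul_add, Nat.sub_add_cancel (by omega : j ≤ Q)]
  exact (Nat.modEq_zero_iff_dvd.2 (dvd_mul_left Q n)).trans (Nat.modEq_zero_iff_dvd.2 hdvd).symm

theorem not_dvd_choose_add_mul {p h e M N : ℕ} (hp : p.Prime) (hh : h < p) (he : e ≤ h)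
    (hMN : ¬ p ∣ M.choose N) : ¬ p ∣ (h + p * M).choose (e + p * N) := by
  have := Fact.mk hp
  intro hdvd
  have := (Choose.choose_modEq_choose_mod_mul_choose_div_nat (n := h + p * M) (k := e + p * N)
    (p := p)).symm.trans (Nat.modEq_zero_iff_dvd.2 hdvd)
  rw [Nat.add_mul_mod_self_left, Nat.add_mul_mod_self_left, Nat.mod_eq_of_lt hh,
    Nat.mod_eq_of_lt (he.trans_lt hh), Nat.add_mul_div_left _ _ hp.pos,
    Nat.add_mul_div_left _ _ hp.pos, Nat.div_eq_of_lt hh, Nat.div_eq_of_lt (he.trans_lt hh),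
    zero_add, zero_add, Nat.modEq_zero_iff_dvd, hp.dvd_mul] at this
  rcases this with h1 | h1
  · have h2 : p ∣ h.factorial := by
      rw [← Nat.choose_mul_factorial_mul_factorial he, mul_assoc]
      exact h1.mul_right _
    exact hh.not_ge ((hp.dvd_factorial).1 h2)
  · exact hMN h1

theorem not_dvd_choose_mul_pow {p h : ℕ} (hp : p.Prime) (hh : h < p) {d s t : ℕ} (hd : d ≤ h)
    (hst : s < t) : ¬ p ∣ (h * ∑ i ∈ Finset.range t, p ^ i).choose (d * p ^ s) := by
  induction t generalizing s with
  | zero => omega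
  | succ t ih =>
    have e : h * ∑ i ∈ Finset.range (t + 1), p ^ i =
        h + p * (h * ∑ i ∈ Finset.range t, p ^ i) := by
      rw [geom_sum_succ]
      ring
    rw [e]
    cases s with
    | zero =>
      have := not_dvd_choose_add_mul (M := h * ∑ i ∈ Finset.range t, p ^ i) (N := 0) hp hh hd
        (by simpa using hp.one_lt.ne')
      simpa using this
    | succ s =>
      have := not_dvd_choose_add_mul hp hh h.zero_le (ih (s := s) (by omega))
      rwa [zero_add, show p * (d * p ^ s) = d * p ^ (s + 1) by ring] at this

theorem not_dvd_choose_mul_pow_add_mul_pow {p h : ℕ} (hp : p.Prime) (hh : h < p) {a b t : ℕ}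
    (hab : a < b) (hbt : b < t) :
    ¬ p ∣ (h * ∑ i ∈ Finset.range t, p ^ i).choose (h * p ^ a + h * p ^ b) := by
  induction t generalizing a b with
  | zero => omega
  | succ t ih =>
    have e : h * ∑ i ∈ Finset.range (t + 1), p ^ i =
        h + p * (h * ∑ i ∈ Finset.range t, p ^ i) := by
      rw [geom_sum_succ]
      ring
    rw [e]
    obtain ⟨b, rfl⟩ : ∃ c, b = c + 1 := ⟨b - 1, by omega⟩
    cases a with
    | zero =>
      have := not_dvd_choose_add_mul hp hh le_rfl
        (not_dvd_choose_mul_pow hp hh (le_refl h) (by omega : b < t))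
      rwa [show h + p * (h * p ^ b) = h * p ^ 0 + h * p ^ (b + 1) by ring] at this
    | succ a =>
      have := not_dvd_choose_add_mul hp hh h.zero_le (ih (a := a) (b := b) (by omega) (by omega))
      rwa [show 0 + p * (h * p ^ a + h * p ^ b) = h * p ^ (a + 1) + h * p ^ (b + 1) by ring]
        at this

theorem two_mul_mul_geom_sum_add_one {p h : ℕ} (hph : p = 2 * h + 1) (k : ℕ) :
    2 * (h * ∑ i ∈ Finset.range k, p ^ i) + 1 = p ^ k := by
  induction k with
  | zero => simp
  | succ k ih =>
    rw [Finset.sum_range_succ, mul_add, mul_add, add_right_comm, ih, pow_succ, hph]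
    ring

/-- If multiplication by `n` modulo `p ^ k - 1` maps the support of the binomial coefficients
`(h * R).choose j` into residues at most `h * R = (p ^ k - 1) / 2`, then `n` is a power of `p`. -/
theorem exists_modEq_pow {p h k n R : ℕ} (hp : p.Prime) (hph : p = 2 * h + 1) (hk : 0 < k)
    (hR : R = ∑ i ∈ Finset.range k, p ^ i)
    (H : ∀ j, 0 < j → ¬ p ∣ (h * R).choose j →
      ∃ i, 0 < i ∧ i ≤ h * R ∧ n * j ≡ i [MOD 2 * (h * R)]) :
    ∃ ℓ < k, n ≡ p ^ ℓ [MOD 2 * (h * R)] := by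
  have hh0 : 0 < h := by
    have := hp.two_le
    omega
  have hhp : h < p := by omega
  have hRQ : 2 * (h * R) + 1 = p ^ k := hR ▸ two_mul_mul_geom_sum_add_one hph k
  have hR0 : 0 < R := by
    rw [hR]
    exact Finset.sum_pos (fun i _ => pow_pos hp.pos i) ⟨0, Finset.mem_range.2 hk⟩
  set Q := 2 * (h * R) with hQ
  have hhR : 0 < h * R := Nat.mul_pos hh0 hR0
  have hpk : p ^ k ≡ 1 [MOD Q] := by
    rw [← hRQ]
    exact Nat.add_modEq_left
  have hpmod : ∀ a, p ^ (a % k) ≡ p ^ a [MOD Q] := by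
    intro a
    conv_rhs => rw [← Nat.mod_add_div a k, pow_add, pow_mul]
    simpa using ((hpk.pow (a / k)).mul_left (p ^ (a % k))).symm
  have huniq : ∀ X i, X ≤ Q → 0 < i → i ≤ h * R → X ≡ i [MOD Q] → X = i := by
    intro X i hX hi0 hi h
    rcases hX.eq_or_lt with hX | hX
    · rw [hX] at h
      have := Nat.ModEq.eq_of_lt_of_lt ((Nat.modEq_zero_iff_dvd.2 (dvd_refl Q)).symm.trans h)
        (by omega) (by omega)
      omega
    · exact h.eq_of_lt_of_lt hX (by omega)
  have hscale : ∀ a d, 0 < d → d ≤ h → ∃ i, 0 < i ∧ i ≤ h * R ∧ n * p ^ a * d ≡ i [MOD Q] := by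
    intro a d hd0 hd
    obtain ⟨i, hi0, hi, hmod⟩ := H (d * p ^ (a % k)) (Nat.mul_pos hd0 (pow_pos hp.pos _))
      (by rw [hR]; exact not_dvd_choose_mul_pow hp hhp hd (Nat.mod_lt a hk))
    refine ⟨i, hi0, hi, Nat.ModEq.trans ?_ hmod⟩
    rw [mul_assoc, mul_comm (p ^ a)]
    exact ((hpmod a).symm.mul_left d).mul_left n
  have hshift : ∀ a, ∃ i, 0 < i ∧ i ≤ h * R ∧ n * p ^ a ≡ i [MOD Q] := by
    intro a
    simpa using hscale a 1 one_pos hh0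
  choose r hr0 hrh hr using hshift
  have hrR : ∀ a, r a ≤ R := by
    intro a
    have hd : ∀ d, d + 1 ≤ h → (d + 1) * r a ≤ h * R := by
      intro d
      induction d with
      | zero => intro _; simpa using hrh a
      | succ d ih =>
        intro hd
        obtain ⟨i, hi0, hi, hmod⟩ := hscale a (d + 1 + 1) (by omega) hd
        have h1 := ih (by omega)
        have h2 := hrh a
        have h3 : (d + 1 + 1) * r a = (d + 1) * r a + r a := by ring
        rw [huniq ((d + 1 + 1) * r a) i (by omega) hi0 hi
          (by rw [mul_comm]; exact ((hr a).symm.mul_right _).trans hmod)]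
        exact hi
    have := hd (h - 1) (by omega)
    rw [Nat.sub_add_cancel hh0] at this
    exact Nat.le_of_mul_le_mul_left this hh0
  have hpair : ∀ a b, a % k ≠ b % k → r a + r b ≤ R := by
    have hlt : ∀ a b, a % k < b % k → r a + r b ≤ R := by
      intro a b hab
      obtain ⟨i, hi0, hi, hmod⟩ := H (h * p ^ (a % k) + h * p ^ (b % k))
        (Nat.add_pos_left (Nat.mul_pos hh0 (pow_pos hp.pos _)) _)
        (by rw [hR]; exact not_dvd_choose_mul_pow_add_mul_pow hp hhp hab (Nat.mod_lt b hk))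
      have h1 : h * (r a + r b) ≡ i [MOD Q] := by
        refine Nat.ModEq.trans ?_ hmod
        have e : n * (h * p ^ (a % k) + h * p ^ (b % k)) =
            h * (n * p ^ (a % k) + n * p ^ (b % k)) := by ring
        rw [e]
        exact (((hr a).symm.trans ((hpmod a).symm.mul_left n)).add
          ((hr b).symm.trans ((hpmod b).symm.mul_left n))).mul_left h
      have h2 : h * (r a + r b) ≤ Q := by
        have := Nat.mul_le_mul_left h (hrR a)
        have := Nat.mul_le_mul_left h (hrR b)
        rw [mul_add]
        omega
      have h3 := huniq _ i h2 hi0 hi h1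
      exact Nat.le_of_mul_le_mul_left (h3.trans_le hi) hh0
    intro a b hab
    rcases lt_or_gt_of_ne hab with h | h
    · exact hlt a b h
    · rw [add_comm]
      exact hlt b a h
  have hstep : ∀ a, p * r a ≤ Q → r (a + 1) = p * r a := by
    intro a ha
    refine (huniq _ _ ha (hr0 _) (hrh _) ?_).symm
    refine Nat.ModEq.trans ((hr a).symm.mul_left p) ?_
    rw [show p * (n * p ^ a) = n * p ^ (a + 1) by ring]
    exact hr (a + 1)
  have hpow : p ^ k = p ^ (k - 1) * p := by
    rw [← pow_succ, Nat.sub_add_cancel hk]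
  have hlarge : ∀ a, Q < p * r a → p ^ (k - 1) ≤ r a := by
    intro a ha
    rw [Nat.lt_iff_add_one_le, hRQ, hpow, mul_comm] at ha
    exact Nat.le_of_mul_le_mul_left ha hp.pos
  have hRlt : R < 2 * p ^ (k - 1) := by
    have h1 : R ≤ h * R := Nat.le_mul_of_pos_left R hh0
    have h2 : p * R = 2 * (h * R) + R := by
      rw [hph]
      ring
    have h3 : p * R < p * (2 * p ^ (k - 1)) := by
      have : p * (2 * p ^ (k - 1)) = 2 * p ^ k := by
        rw [hpow]
        ring
      omega
    exact Nat.lt_of_mul_lt_mul_left h3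
  obtain ⟨a, ha⟩ : ∃ a, Q < p * r a := by
    by_contra! hcon
    have hr' : ∀ a, r a = p ^ a * r 0 := by
      intro a
      induction a with
      | zero => simp
      | succ a ih =>
        rw [hstep a (hcon a), ih]
        ring
    have h1 := hrR R
    rw [hr'] at h1
    have h2 : R < p ^ R := Nat.lt_pow_self hp.one_lt
    have h3 : p ^ R ≤ p ^ R * r 0 := Nat.le_mul_of_pos_right _ (hr0 0)
    omega
  have hiter : ∀ t, t < k → r (a + 1 + t) = p ^ t * r (a + 1) := by
    intro t
    induction t with
    | zero => simp
    | succ t ih =>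
      intro ht
      rw [← add_assoc, hstep, ih (by omega)]
      · ring
      · by_contra! hcon
        have h1 := hpair a (a + 1 + t) (by
          intro hmod
          have h2 : k ∣ a + (1 + t) - a := (Nat.modEq_iff_dvd' (by omega)).1
            (by rw [← add_assoc]; exact hmod)
          have := Nat.le_of_dvd (by omega) h2
          omega)
        have := hlarge _ ha
        have := hlarge _ hcon
        omega
  have hone : r (a + 1) = 1 := by
    have h1 := hrR (a + 1 + (k - 1))
    rw [hiter _ (by omega)] at h1
    have h2 : p ^ (k - 1) * r (a + 1) < p ^ (k - 1) * 2 := by omega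
    have := Nat.lt_of_mul_lt_mul_left h2
    have := hr0 (a + 1)
    omega
  have hinv : n * p ^ (a + 1) ≡ 1 [MOD Q] := by
    have := hr (a + 1)
    rwa [hone] at this
  obtain ⟨b, hb⟩ : ∃ b, a + 1 + b = k * (a + 1) := ⟨k * (a + 1) - (a + 1),
    Nat.add_sub_cancel' (Nat.le_mul_of_pos_left _ hk)⟩
  refine ⟨b % k, Nat.mod_lt _ hk, Nat.ModEq.trans ?_ (hpmod b).symm⟩
  have h1 : n * p ^ (k * (a + 1)) ≡ n [MOD Q] := by
    simpa [pow_mul] using (hpk.pow (a + 1)).mul_left n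
  refine h1.symm.trans ?_
  rw [← hb, pow_add, ← mul_assoc]
  simpa using hinv.mul_right (p ^ b)

/-- over `F = 𝔽_{p^k}` with `q ≡ 3 (mod 4)`, if `f` preserves positivity on
`M_2(F)` and `f 1 = 1`, then `f x = x^{p^ℓ}` for some `0 ≤ ℓ ≤ k − 1`. -/
theorem stmt3 {F : Type*} [Field F] [Fintype F] (p k : ℕ) (hp : p.Prime)
    (hcard : Fintype.card F = p ^ k) (hq : Fintype.card F % 4 = 3) (f : F → F)
    (hpres : PreservesPos 2 f) (hf1 : f 1 = 1) :
    ∃ ℓ : ℕ, ℓ ≤ k - 1 ∧ ∀ x : F, f x = x ^ p ^ ℓ := by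
  have hm1 : Fintype.card F / 2 < Fintype.card F - 1 := by omega
  have hmul := hpres.map_mul hq hf1
  have h0 := hpres.map_zero hq hf1
  let g : F →* F := ⟨⟨f, hf1⟩, hmul⟩
  have hginj : Function.Injective (Units.map g) := by
    refine (injective_iff_map_eq_one _).2 fun u hu => ?_
    have hfu : f u = 1 := congrArg Units.val hu
    rcases isPos_trichotomy hq (u : F) with h | h | h
    · exact absurd h u.ne_zero
    · exact Units.ext (hpres.eq_of_apply_eq hq h isPos_one (hfu.trans hf1.symm))
    · have h1 := hpres.isPos_apply h
      rw [hpres.map_neg hq hf1, hfu] at h1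
      exact absurd h1 (isPos_one.not_neg hq)
  obtain ⟨n, hn⟩ : ∃ n : ℕ, ∀ u : Fˣ, Units.map g u = u ^ n := by
    obtain ⟨x, hx⟩ := IsCyclic.exists_monoid_generator (α := Fˣ)
    obtain ⟨n, hn⟩ := hx (Units.map g x)
    refine ⟨n, fun u => ?_⟩
    obtain ⟨s, rfl⟩ := hx u
    rw [map_pow, ← hn]
    exact pow_right_comm x n s
  have hfn : ∀ u : Fˣ, f u = (u : F) ^ n := fun u => congrArg Units.val (hn u)
  have hninj : Function.Injective fun u : Fˣ => u ^ n := by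
    rw [← funext hn]
    exact hginj
  have := Fact.mk hp
  have hk : 0 < k := by
    rcases Nat.eq_zero_or_pos k with rfl | h
    · rw [hcard, pow_zero] at hq
      omega
    · exact h
  have : CharP F p := charP_of_card_eq_prime_pow hcard
  obtain ⟨h, hph⟩ : ∃ h, p = 2 * h + 1 := by
    refine hp.eq_two_or_odd'.resolve_left ?_
    rintro rfl
    have : 2 ∣ 2 ^ k := dvd_pow_self 2 hk.ne'
    omega
  have hR : h * ∑ i ∈ Finset.range k, p ^ i = Fintype.card F / 2 := by
    have := two_mul_mul_geom_sum_add_one hph k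
    omega
  have hQ : 2 * (h * ∑ i ∈ Finset.range k, p ^ i) = Fintype.card F - 1 := by omega
  obtain ⟨ℓ, hℓ, hnℓ⟩ := exists_modEq_pow (n := n) hp hph hk rfl fun j hj0 hj => by
    rw [hQ]
    rw [hR] at hj ⊢
    obtain ⟨i, hi, hmod⟩ := exists_modEq_of_sub_one_pow_eq (j := j) hm1
      (Finite.injective_iff_bijective.1 hninj)
      (fun u => by rw [← hfn]; exact hpres.sub_one_pow hq hf1 u)
      (by rwa [Ne, CharP.cast_eq_zero_iff F p])
    refine ⟨i, Nat.pos_of_ne_zero ?_, hi, hmod⟩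
    rintro rfl
    have hjm : j ≤ Fintype.card F / 2 := by
      by_contra! hlt
      exact hj (by rw [Nat.choose_eq_zero_of_lt hlt]; exact dvd_zero p)
    have hdvd : Fintype.card F - 1 ∣ j := by
      refine (FiniteField.forall_pow_eq_one_iff F j).1 fun u => hninj ?_
      have := (FiniteField.forall_pow_eq_one_iff F _).2 (Nat.modEq_zero_iff_dvd.1 hmod) u
      simp only [one_pow, ← pow_mul]
      rwa [mul_comm j n]
    have := Nat.le_of_dvd hj0 hdvd
    omega
  rw [hQ] at hnℓ
  refine ⟨ℓ, by omega, fun x => ?_⟩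
  by_cases hx : x = 0
  · rw [hx, h0, zero_pow (pow_ne_zero _ hp.ne_zero)]
  · have hpow : ∀ e, x ^ e = x ^ (e % (Fintype.card F - 1)) := by
      intro e
      conv_lhs => rw [← Nat.mod_add_div e (Fintype.card F - 1), pow_add, pow_mul,
        FiniteField.pow_card_sub_one_eq_one x hx, one_pow, mul_one]
    rw [show f x = x ^ n from hfn (Units.mk0 x hx), hpow n, hnℓ, ← hpow]
end

section
/- Let q = p^k be a prime power with q ≡ 1 (mod 4), and let f : F_q → F_q. Then f preserves positivity on M_3(F_q) if and only if f is a positive multiple of a field automorphism of F_q, i.e., there exist c ∈ F_q^+ and an integer ℓ with 0 ≤ ℓ ≤ k−1 such that f(x) = c·x^{p^ℓ} for all x ∈ F_q. -/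
namespace IsPos

variable {F : Type*} [Field F] {a b : F}

lemma ne_zero_s4 (h : IsPos a) : a ≠ 0 := by
  obtain ⟨y, hy, rfl⟩ := h
  exact pow_ne_zero 2 hy

lemma sq (h : a ≠ 0) : IsPos (a ^ 2) := ⟨a, h, rfl⟩

lemma one : IsPos (1 : F) := ⟨1, one_ne_zero, one_pow 2⟩

lemma mul_s4 (ha : IsPos a) (hb : IsPos b) : IsPos (a * b) := by
  obtain ⟨x, hx, rfl⟩ := ha
  obtain ⟨y, hy, rfl⟩ := hb
  exact ⟨x * y, mul_ne_zero hx hy, mul_pow x y 2⟩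

lemma inv_s4 (ha : IsPos a) : IsPos a⁻¹ := by
  obtain ⟨x, hx, rfl⟩ := ha
  exact ⟨x⁻¹, inv_ne_zero hx, inv_pow x 2⟩

lemma pow_s4 (ha : IsPos a) (n : ℕ) : IsPos (a ^ n) := by
  obtain ⟨x, hx, rfl⟩ := ha
  exact ⟨x ^ n, pow_ne_zero n hx, pow_right_comm x n 2⟩

lemma map {φ : F →+* F} (ha : IsPos a) : IsPos (φ a) := by
  obtain ⟨x, hx, rfl⟩ := ha
  exact ⟨φ x, (map_ne_zero φ).2 hx, (map_pow φ x 2).symm⟩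

lemma mul_iff (ha : IsPos a) : IsPos (a * b) ↔ IsPos b := by
  refine ⟨fun h => ?_, ha.mul_s4⟩
  simpa [ha.ne_zero_s4] using ha.inv_s4.mul_s4 h

end IsPos

lemma isPosDef_fin_three {F : Type*} [Field F] (a b c d e g : F) :
    IsPosDef !![a, b, c; b, d, e; c, e, g] ↔
      IsPos a ∧ IsPos (a * d - b ^ 2) ∧
        IsPos (g * (a * d - b ^ 2) - (d * c ^ 2 - 2 * b * c * e + a * e ^ 2)) := by
  have hsymm : (!![a, b, c; b, d, e; c, e, g] : Matrix (Fin 3) (Fin 3) F).IsSymm := by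
    ext i j
    fin_cases i <;> fin_cases j <;> rfl
  have h0 : leadingMinor !![a, b, c; b, d, e; c, e, g] 0 = a := by
    simp [leadingMinor]
  have h1 : leadingMinor !![a, b, c; b, d, e; c, e, g] 1 = a * d - b ^ 2 := by
    rw [leadingMinor]
    refine (Matrix.det_fin_two _).trans ?_
    simp [Fin.castLE]
    ring
  have h2 : leadingMinor !![a, b, c; b, d, e; c, e, g] 2 =
      g * (a * d - b ^ 2) - (d * c ^ 2 - 2 * b * c * e + a * e ^ 2) := by
    rw [leadingMinor]
    refine (Matrix.det_fin_three _).trans ?_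
    simp
    ring
  rw [IsPosDef, Fin.forall_fin_succ, Fin.forall_fin_two]
  exact ⟨fun h => ⟨h0 ▸ h.2.1, h1 ▸ h.2.2.1, h2 ▸ h.2.2.2⟩,
    fun h => ⟨hsymm, h0.symm ▸ h.1, h1.symm ▸ h.2.1, h2.symm ▸ h.2.2⟩⟩

lemma entrywiseMap_fin_three {F : Type*} (f : F → F) (a b c d e g : F) :
    entrywiseMap f !![a, b, c; b, d, e; c, e, g] =
      !![f a, f b, f c; f b, f d, f e; f c, f e, f g] := by
  ext i j
  fin_cases i <;> fin_cases j <;> rfl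

lemma PreservesPos.const_mul {F : Type*} [Field F] {n : ℕ} {f : F → F} (hf : PreservesPos n f)
    {c : F} (hc : IsPos c) : PreservesPos n fun x => c * f x := by
  intro A hA
  have hE : entrywiseMap (fun x => c * f x) A = c • entrywiseMap f A := rfl
  obtain ⟨h1, h2⟩ := hf A hA
  refine ⟨hE ▸ h1.smul c, fun r => ?_⟩
  have : leadingMinor (c • entrywiseMap f A) r =
      c ^ ((r : ℕ) + 1) * leadingMinor (entrywiseMap f A) r := by
    rw [leadingMinor, Matrix.submatrix_smul, Pi.smul_apply, Pi.smul_apply, Matrix.det_smul,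
      Fintype.card_fin, leadingMinor]
  rw [hE, this]
  exact (hc.pow_s4 _).mul_s4 (h2 r)

lemma PreservesPos.ringHom {F : Type*} [Field F] (n : ℕ) (φ : F →+* F) : PreservesPos n φ := by
  rintro A ⟨h1, h2⟩
  refine ⟨h1.map φ, fun r => ?_⟩
  have : leadingMinor (entrywiseMap φ A) r = φ (leadingMinor A r) := by
    rw [leadingMinor, leadingMinor, RingHom.map_det]
    rfl
  exact this ▸ (h2 r).map

section Squares

variable {F : Type*} [Field F]

lemma exists_sq_add_sq (h2 : (2 : F) ≠ 0) (hi : IsSquare (-1 : F)) (z : F) :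
    ∃ x y : F, x ^ 2 + y ^ 2 = z := by
  obtain ⟨i, hi⟩ := hi
  refine ⟨(z + 1) / 2, i * ((z - 1) / 2), ?_⟩
  rw [mul_pow, pow_two i, ← hi]
  field_simp
  ring

/-- The set of positive elements is not stable under any nonzero translation. -/
lemma eq_zero_of_isPos_add (h2 : (2 : F) ≠ 0) (hi : IsSquare (-1 : F)) {d : F}
    (h : ∀ s : F, IsPos s → IsPos (s + d)) : d = 0 := by
  by_contra hd
  have key (s : F) (hs : IsPos s) (x : F) : IsPos (s + d * x ^ 2) := by
    rcases eq_or_ne x 0 with rfl | hx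
    · simpa using hs
    · have hx2 := IsPos.sq hx
      convert hx2.mul_s4 (h _ (hx2.inv_s4.mul_s4 hs)) using 1
      field_simp
  obtain ⟨x, y, hxy⟩ := exists_sq_add_sq h2 hi (-d⁻¹)
  refine (key _ (key 1 IsPos.one x) y).ne_zero_s4 ?_
  rw [add_assoc, ← mul_add, hxy]
  field_simp
  ring

lemma eq_of_isPos_sub_iff (h2 : (2 : F) ≠ 0) (hi : IsSquare (-1 : F)) {s t : F}
    (h : ∀ y : F, IsPos (y - s) ↔ IsPos (y - t)) : s = t := by
  refine sub_eq_zero.1 (eq_zero_of_isPos_add h2 hi fun r hr => ?_)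
  have := (h (r + s)).1 (by simpa using hr)
  rwa [add_sub_assoc] at this

end Squares

namespace PreservesPos

variable {F : Type*} [Field F] {f : F → F}

lemma fin_three_apply (hf : PreservesPos 3 f) {a b c d e g : F} (ha : IsPos a)
    (hd : IsPos (a * d - b ^ 2))
    (hg : IsPos (g * (a * d - b ^ 2) - (d * c ^ 2 - 2 * b * c * e + a * e ^ 2))) :
    IsPos (f a) ∧ IsPos (f a * f d - f b ^ 2) ∧
      IsPos (f g * (f a * f d - f b ^ 2) -
        (f d * f c ^ 2 - 2 * f b * f c * f e + f a * f e ^ 2)) := by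
  have := hf _ ((isPosDef_fin_three a b c d e g).2 ⟨ha, hd, hg⟩)
  rwa [entrywiseMap_fin_three, isPosDef_fin_three] at this

lemma injective (hi : IsSquare (-1 : F)) (hf : PreservesPos 3 f) : Function.Injective f := by
  intro x y hxy
  by_contra hne
  obtain ⟨i, hi⟩ := hi
  have hi0 : i ≠ 0 := by
    rintro rfl
    simp at hi
  obtain ⟨-, -, h⟩ := hf.fin_three_apply (a := 1) (b := x) (c := 1) (d := x ^ 2 + 1) (e := y)
    (g := 1) IsPos.one (by simpa using IsPos.one)
    ⟨i * (x - y), mul_ne_zero hi0 (sub_ne_zero.2 hne), by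
      rw [mul_pow, pow_two i, ← hi]
      ring⟩
  refine h.ne_zero_s4 ?_
  rw [hxy]
  ring

lemma isPos_apply_s4 (hf : PreservesPos 3 f) {a : F} (ha : IsPos a) : IsPos (f a) :=
  (hf.fin_three_apply (a := a) (b := 0) (c := 0) (d := 1) (e := 0) (g := 1) ha (by simpa using ha)
    (by simpa using ha)).1

lemma apply_isPos_two (hf : PreservesPos 3 f) {a b d : F} (ha : IsPos a)
    (hd : IsPos (a * d - b ^ 2)) : IsPos (f a * f d - f b ^ 2) :=
  (hf.fin_three_apply (a := a) (b := b) (c := 0) (d := d) (e := 0) (g := 1) ha hd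
    (by simpa using hd)).2.1

variable [Finite F]

lemma isPosDef_iff (hi : IsSquare (-1 : F)) (hf : PreservesPos 3 f)
    (A : Matrix (Fin 3) (Fin 3) F) : IsPosDef (entrywiseMap f A) ↔ IsPosDef A := by
  refine ⟨fun h => ?_, hf A⟩
  have hinj : Function.Injective (entrywiseMap f : Matrix (Fin 3) (Fin 3) F → _) :=
    fun A B h => Matrix.ext fun i j => hf.injective hi (congrFun (congrFun h i) j)
  let T : {A : Matrix (Fin 3) (Fin 3) F // IsPosDef A} →
      {A : Matrix (Fin 3) (Fin 3) F // IsPosDef A} := fun A => ⟨entrywiseMap f A.1, hf A.1 A.2⟩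
  have hT : Function.Injective T := fun A B h => Subtype.ext (hinj (congrArg Subtype.val h))
  obtain ⟨B, hB⟩ := Finite.surjective_of_injective hT ⟨_, h⟩
  exact hinj (congrArg Subtype.val hB) ▸ B.2

lemma fin_three_iff (hi : IsSquare (-1 : F)) (hf : PreservesPos 3 f) (a b c d e g : F) :
    (IsPos (f a) ∧ IsPos (f a * f d - f b ^ 2) ∧
      IsPos (f g * (f a * f d - f b ^ 2) -
        (f d * f c ^ 2 - 2 * f b * f c * f e + f a * f e ^ 2))) ↔
    IsPos a ∧ IsPos (a * d - b ^ 2) ∧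
      IsPos (g * (a * d - b ^ 2) - (d * c ^ 2 - 2 * b * c * e + a * e ^ 2)) := by
  rw [← isPosDef_fin_three, ← isPosDef_fin_three, ← entrywiseMap_fin_three, hf.isPosDef_iff hi]

lemma exists_isPos_apply_eq (hi : IsSquare (-1 : F)) (hf : PreservesPos 3 f) {y : F}
    (hy : IsPos y) : ∃ x, IsPos x ∧ f x = y := by
  let T : {x : F // IsPos x} → {x : F // IsPos x} := fun x => ⟨f x.1, hf.isPos_apply_s4 x.2⟩
  have hT : Function.Injective T :=
    fun x y h => Subtype.ext (hf.injective hi (congrArg Subtype.val h))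
  obtain ⟨x, hx⟩ := Finite.surjective_of_injective hT ⟨y, hy⟩
  exact ⟨x.1, x.2, congrArg Subtype.val hx⟩

lemma map_zero_s4 (h2 : (2 : F) ≠ 0) (hi : IsSquare (-1 : F)) (hf : PreservesPos 3 f) : f 0 = 0 := by
  refine pow_eq_zero_iff two_ne_zero |>.1 (neg_eq_zero.1 (eq_zero_of_isPos_add h2 hi fun s hs => ?_))
  have h1 := hf.isPos_apply_s4 IsPos.one
  obtain ⟨x, hx, hxs⟩ := hf.exists_isPos_apply_eq hi (h1.inv_s4.mul_s4 hs)
  have := hf.apply_isPos_two (a := 1) (b := 0) (d := x) IsPos.one (by simpa using hx)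
  rwa [hxs, mul_inv_cancel_left₀ h1.ne_zero_s4, sub_eq_add_neg] at this

variable (h2 : (2 : F) ≠ 0) (hi : IsSquare (-1 : F)) (hf : PreservesPos 3 f)
include h2 hi hf

/-- Translates of the positive set are mapped to translates, and the image translate is
determined by the source translate. -/
lemma eq_of_isPos_sub_iff {s t u : F} (ht : ∀ g, IsPos (f g - t) ↔ IsPos (g - s))
    (hu : ∀ g, IsPos (f g - u) ↔ IsPos (g - s)) : t = u := by
  refine _root_.eq_of_isPos_sub_iff h2 hi fun y => ?_
  obtain ⟨g, rfl⟩ := Finite.surjective_of_injective (hf.injective hi) y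
  rw [ht, hu]

variable (h1 : f 1 = 1)
include h1

lemma isPos_sub_sq_add_sq_iff (c e g : F) :
    IsPos (f g - (f c ^ 2 + f e ^ 2)) ↔ IsPos (g - (c ^ 2 + e ^ 2)) := by
  have := hf.fin_three_iff hi 1 0 c 1 e g
  simpa [h1, hf.map_zero_s4 h2 hi, IsPos.one] using this

lemma isPos_sub_iff {a : F} (ha : IsPos a) (g : F) : IsPos (f g - f a) ↔ IsPos (g - a) := by
  have := hf.fin_three_iff hi a a 0 g 0 1
  have ha' := hf.isPos_apply_s4 ha
  simp only [h1, hf.map_zero_s4 h2 hi, ha, ha', true_and] at this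
  simp only [mul_zero, sub_zero, one_mul,
    add_zero, and_self, pow_two, ← mul_sub, ha.mul_iff, ha'.mul_iff] at this
  exact this

lemma map_sq_s4 (c : F) : f (c ^ 2) = f c ^ 2 := by
  rcases eq_or_ne c 0 with rfl | hc
  · simp [hf.map_zero_s4 h2 hi]
  · refine hf.eq_of_isPos_sub_iff h2 hi (s := c ^ 2)
      (hf.isPos_sub_iff h2 hi h1 (IsPos.sq hc)) fun g => ?_
    simpa [hf.map_zero_s4 h2 hi] using hf.isPos_sub_sq_add_sq_iff h2 hi h1 c 0 g

lemma sub_sq_eq_mul (b e : F) :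
    (f e - f b) ^ 2 = f (e - b) ^ 2 * (f (b ^ 2 + 1) - f b ^ 2) := by
  have hd : IsPos (f (b ^ 2 + 1) - f b ^ 2) := by
    simpa [h1] using hf.apply_isPos_two (a := 1) (b := b) (d := b ^ 2 + 1) IsPos.one
      (by simpa using IsPos.one)
  have key := hf.eq_of_isPos_sub_iff h2 hi (s := 1 ^ 2 + (e - b) ^ 2)
    (t := f 1 ^ 2 + (f e - f b) ^ 2 / (f (b ^ 2 + 1) - f b ^ 2)) (u := f 1 ^ 2 + f (e - b) ^ 2)
    (fun g => ?_) (hf.isPos_sub_sq_add_sq_iff h2 hi h1 1 (e - b))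
  · rwa [add_right_inj, div_eq_iff hd.ne_zero_s4] at key
  · have := hf.fin_three_iff hi 1 b 1 (b ^ 2 + 1) e g
    simp only [h1, one_mul, IsPos.one, hd, true_and, add_sub_cancel_left] at this
    rw [h1, ← hd.mul_iff]
    convert this using 2
    · have := hd.ne_zero_s4
      field_simp
      ring
    · ring

lemma sub_sq_eq (b e : F) : (f e - f b) ^ 2 = f (e - b) ^ 2 := by
  have h0 := hf.map_zero_s4 h2 hi
  rcases eq_or_ne b 0 with rfl | hb
  · simp [h0]
  · have hfb : f b ^ 2 ≠ 0 :=
      pow_ne_zero 2 fun h => hb (hf.injective hi (h.trans h0.symm))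
    have h := hf.sub_sq_eq_mul h2 hi h1 b 0
    have hneg : f (0 - b) ^ 2 = f b ^ 2 := by
      rw [← hf.map_sq_s4 h2 hi h1, ← hf.map_sq_s4 h2 hi h1]
      ring_nf
    rw [hneg, h0, zero_sub, neg_sq, left_eq_mul₀ hfb] at h
    rw [hf.sub_sq_eq_mul h2 hi h1, h, mul_one]

lemma map_neg_s4 (x : F) : f (-x) = -f x := by
  have h0 := hf.map_zero_s4 h2 hi
  have h := hf.sub_sq_eq h2 hi h1 x 0
  rw [h0, zero_sub, zero_sub, neg_sq, sq_eq_sq_iff_eq_or_eq_neg] at h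
  rcases h with h | h
  · have hx : 2 * x = 0 := by linear_combination hf.injective hi h
    obtain rfl : x = 0 := (mul_eq_zero.1 hx).resolve_left h2
    simp [h0]
  · rw [h, neg_neg]

lemma map_add (x y : F) : f (x + y) = f x + f y := by
  have h0 := hf.map_zero_s4 h2 hi
  have hn := hf.map_neg_s4 h2 hi h1
  have h := hf.sub_sq_eq h2 hi h1 (-y) x
  rw [hn, sub_neg_eq_add, sub_neg_eq_add, sq_eq_sq_iff_eq_or_eq_neg] at h
  rcases h with h | h
  · exact h.symm
  · have h' := hf.sub_sq_eq h2 hi h1 y (x + y)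
    rw [add_sub_cancel_right] at h'
    rw [show f (x + y) = -(f x + f y) by rw [h, neg_neg]] at h'
    have hxy : (2 * 2) * (f y * (f x + f y)) = 0 := by linear_combination h'
    replace hxy := (mul_eq_zero.1 hxy).resolve_left (mul_ne_zero h2 h2)
    rcases mul_eq_zero.1 hxy with hy | hs
    · obtain rfl : y = 0 := hf.injective hi (hy.trans h0.symm)
      simp [h0]
    · linear_combination h - 2 * hs

lemma map_mul_s4 (x y : F) : f (x * y) = f x * f y := by
  have hadd := hf.map_add h2 hi h1
  have hsq := hf.map_sq_s4 h2 hi h1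
  have h : f ((x + y) ^ 2) = f (x ^ 2) + (f (x * y) + f (x * y)) + f (y ^ 2) := by
    rw [← hadd, ← hadd, ← hadd]
    ring_nf
  rw [hsq, hsq, hsq, hadd] at h
  exact mul_left_cancel₀ h2 (by linear_combination -h)

end PreservesPos

lemma RingHom.exists_eq_pow_of_card {F : Type*} [Field F] [Fintype F] {p k : ℕ} (hp : p.Prime)
    (hcard : Fintype.card F = p ^ k) (φ : F →+* F) :
    ∃ ℓ ≤ k - 1, ∀ x : F, φ x = x ^ p ^ ℓ := by
  have := Fact.mk hp
  have : CharP F p := charP_of_card_eq_prime_pow hcard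
  let _ := ZMod.algebra F p
  obtain ⟨ℓ, hℓ⟩ := (FiniteField.bijective_frobeniusAlgHom_pow (ZMod p) F).2
    { φ with
      commutes' := RingHom.congr_fun
        (RingHom.ext_zmod (φ.comp (algebraMap (ZMod p) F)) (algebraMap (ZMod p) F)) }
  have hk : Module.finrank (ZMod p) F = k := by
    have h := Module.card_eq_pow_finrank (K := ZMod p) (V := F)
    rw [hcard, ZMod.card] at h
    exact (Nat.pow_right_injective hp.two_le h).symm
  refine ⟨ℓ, by have := ℓ.2; omega, fun x => ?_⟩
  have h : (FiniteField.frobeniusAlgHom (ZMod p) F ^ (ℓ : ℕ)) x = φ x := DFunLike.congr_fun hℓ x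
  rw [← h, AlgHom.coe_pow, FiniteField.coe_frobeniusAlgHom, pow_iterate, ZMod.card]

/-- over `F = 𝔽_{p^k}` with `q ≡ 1 (mod 4)`, `f` preserves positivity on
`M_3(F)` iff `f` is a positive multiple of a field automorphism, i.e.
`f x = c x^{p^ℓ}` with `c ∈ F⁺` and `0 ≤ ℓ ≤ k − 1`. -/
theorem stmt4 {F : Type*} [Field F] [Fintype F] (p k : ℕ) (hp : p.Prime)
    (hcard : Fintype.card F = p ^ k) (hq : Fintype.card F % 4 = 1) (f : F → F) :
    PreservesPos 3 f ↔
      ∃ (c : F) (ℓ : ℕ), IsPos c ∧ ℓ ≤ k - 1 ∧ ∀ x : F, f x = c * x ^ p ^ ℓ := by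
  have hi : IsSquare (-1 : F) := FiniteField.isSquare_neg_one_iff.2 (by omega)
  have h2 : (2 : F) ≠ 0 := Ring.two_ne_zero fun h => by
    have := FiniteField.even_card_iff_char_two.1 h
    omega
  constructor
  · intro hf
    have hc := hf.isPos_apply_s4 IsPos.one
    have hg := hf.const_mul hc.inv_s4
    have hg1 : (f 1)⁻¹ * f 1 = 1 := inv_mul_cancel₀ hc.ne_zero_s4
    let φ : F →+* F :=
      { toFun := fun x => (f 1)⁻¹ * f x
        map_one' := hg1
        map_mul' := hg.map_mul_s4 h2 hi hg1
        map_zero' := hg.map_zero_s4 h2 hi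
        map_add' := hg.map_add h2 hi hg1 }
    obtain ⟨ℓ, hℓ, h⟩ := φ.exists_eq_pow_of_card hp hcard
    refine ⟨f 1, ℓ, hc, hℓ, fun x => ?_⟩
    rw [← h x]
    exact (mul_inv_cancel_left₀ hc.ne_zero_s4 _).symm
  · rintro ⟨c, ℓ, hc, -, h⟩
    have := Fact.mk hp
    have : CharP F p := charP_of_card_eq_prime_pow hcard
    rw [show f = fun x => c * iterateFrobenius F p ℓ x from funext h]
    exact (PreservesPos.ringHom 3 (iterateFrobenius F p ℓ)).const_mul hc
end

section
/- Let q = p^k be a prime power with q ≡ 1 (mod 4) such that q is a perfect square (q = r^2 for an odd integer r). If f : F_q → F_q preserves positivity on M_2(F_q), then there exist a ∈ F_q^+ and an integer j with 0 ≤ j ≤ k−1 such that f(x) = a·x^{p^j} for all x ∈ F_q. -/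
section

open Finset

theorem choose_add_mul_modEq {p : ℕ} [Fact p.Prime] {a c : ℕ} (ha : a < p) (hc : c < p) (b e : ℕ) :
    (a + p * b).choose (c + p * e) ≡ a.choose c * b.choose e [MOD p] := by
  have hp : 0 < p := by omega
  have := Choose.choose_modEq_choose_mod_mul_choose_div_nat (n := a + p * b) (k := c + p * e) (p := p)
  simpa [Nat.add_mul_div_left _ _ hp, Nat.mod_eq_of_lt ha, Nat.mod_eq_of_lt hc,
    Nat.div_eq_of_lt ha, Nat.div_eq_of_lt hc] using this

theorem pow_succ_sub_one_half {p : ℕ} (hodd : Odd p) (k : ℕ) :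
    (p ^ (k + 1) - 1) / 2 = (p - 1) / 2 + p * ((p ^ k - 1) / 2) := by
  obtain ⟨m, hm⟩ : Odd (p ^ k) := hodd.pow
  obtain ⟨h, rfl⟩ := hodd
  have h1 : (2 * h + 1 - 1) / 2 = h := by omega
  have h2 : ((2 * h + 1) ^ k - 1) / 2 = m := by omega
  rw [h1, h2, pow_succ, hm]
  have : (2 * m + 1) * (2 * h + 1) = 2 * (h + (2 * h + 1) * m) + 1 := by ring
  rw [this, Nat.add_sub_cancel, Nat.mul_div_cancel_left _ two_pos]

theorem choose_half_mul_pow_modEq_one {p : ℕ} [hp : Fact p.Prime] (hodd : Odd p) (s : ℕ) :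
    ∀ k, s < k → ((p ^ k - 1) / 2).choose ((p - 1) / 2 * p ^ s) ≡ 1 [MOD p] := by
  have hp0 := hp.out.pos
  induction s with
  | zero =>
    intro k hk
    obtain ⟨l, rfl⟩ : ∃ l, k = l + 1 := ⟨k - 1, by omega⟩
    rw [pow_succ_sub_one_half hodd]
    have := choose_add_mul_modEq (p := p) (a := (p - 1) / 2) (c := (p - 1) / 2)
      (by omega) (by omega) ((p ^ l - 1) / 2) 0
    simpa using this
  | succ s ih =>
    intro k hk
    obtain ⟨l, rfl⟩ : ∃ l, k = l + 1 := ⟨k - 1, by omega⟩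
    rw [pow_succ_sub_one_half hodd]
    have := choose_add_mul_modEq (p := p) (a := (p - 1) / 2) (c := 0)
      (by omega) (by omega) ((p ^ l - 1) / 2) ((p - 1) / 2 * p ^ s)
    rw [Nat.choose_zero_right, one_mul, zero_add] at this
    rw [show (p - 1) / 2 * p ^ (s + 1) = p * ((p - 1) / 2 * p ^ s) by ring]
    exact this.trans (ih l (by omega))

theorem choose_half_modEq_one {p k s : ℕ} [hp : Fact p.Prime] (hodd : Odd p) (hs : 0 < s)
    (hsk : s < k) :
    ((p ^ k - 1) / 2).choose ((p - 1) / 2 * (1 + p ^ s)) ≡ 1 [MOD p] := by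
  have hp0 := hp.out.pos
  obtain ⟨l, rfl⟩ : ∃ l, k = l + 1 := ⟨k - 1, by omega⟩
  obtain ⟨t, rfl⟩ : ∃ t, s = t + 1 := ⟨s - 1, by omega⟩
  rw [pow_succ_sub_one_half hodd]
  have := choose_add_mul_modEq (p := p) (a := (p - 1) / 2) (c := (p - 1) / 2)
    (by omega) (by omega) ((p ^ l - 1) / 2) ((p - 1) / 2 * p ^ t)
  rw [Nat.choose_self, one_mul] at this
  rw [show (p - 1) / 2 * (1 + p ^ (t + 1)) = (p - 1) / 2 + p * ((p - 1) / 2 * p ^ t) by ring]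
  exact this.trans (choose_half_mul_pow_modEq_one hodd t l (by omega))

theorem not_dvd_choose_half {p k i : ℕ} [hp : Fact p.Prime] (hodd : Odd p) (hk : 0 < k)
    (hi : i ≤ (p - 1) / 2) : ¬ p ∣ ((p ^ k - 1) / 2).choose i := by
  have hp0 := hp.out.pos
  obtain ⟨l, rfl⟩ : ∃ l, k = l + 1 := ⟨k - 1, by omega⟩
  rw [pow_succ_sub_one_half hodd]
  have := choose_add_mul_modEq (p := p) (a := (p - 1) / 2) (c := i)
    (by omega) (by omega) ((p ^ l - 1) / 2) 0
  rw [mul_zero, add_zero, Nat.choose_zero_right, mul_one] at this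
  rw [this.dvd_iff dvd_rfl]
  intro hdvd
  have h1 : p ∣ ((p - 1) / 2).factorial := by
    rw [← Nat.choose_mul_factorial_mul_factorial hi, mul_assoc]
    exact hdvd.mul_right _
  rw [hp.out.dvd_factorial] at h1
  omega

theorem exists_eq_pow_of_mod_le_half {p k d : ℕ} (hp : 3 ≤ p) (hodd : Odd p) (hk : 2 ≤ k)
    (hd : d.Coprime (p ^ k - 1))
    (hsmall : ∀ j i, i ≤ (p - 1) / 2 → d * p ^ j * i % (p ^ k - 1) ≤ (p ^ k - 1) / 2)
    (hpair : ∀ j s, 0 < s → s < k →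
      d * p ^ j * ((p - 1) / 2 * (1 + p ^ s)) % (p ^ k - 1) ≤ (p ^ k - 1) / 2) :
    ∃ j < k, d ≡ p ^ j [MOD p ^ k - 1] := by
  obtain ⟨h, rfl⟩ := hodd
  have hh : (2 * h + 1 - 1) / 2 = h := by omega
  rw [hh] at hsmall hpair
  set p := 2 * h + 1 with hpdef
  have hpo : Odd p := ⟨h, rfl⟩
  obtain ⟨m, hm⟩ : Odd (p ^ k) := hpo.pow
  have hq1 : p ^ k - 1 = 2 * m := by omega
  have hq2 : (p ^ k - 1) / 2 = m := by omega
  rw [hq2, hq1] at hsmall hpair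
  rw [hq1] at hd ⊢
  have hpk : p ^ k = p * p ^ (k - 1) := by
    rw [← pow_succ']; congr 1; omega
  have hpk1 : p ≤ p ^ (k - 1) := Nat.le_self_pow (by omega) p
  have hcop : (2 * m).Coprime p := by
    have : Nat.Coprime (2 * m) (2 * m + 1) := by simp
    rw [← hm, hpk] at this
    exact Nat.Coprime.coprime_mul_right_right this
  have hpm : p < 2 * m := by nlinarith
  have hkmod : p ^ k ≡ 1 [MOD 2 * m] := by
    rw [hm]; simp [Nat.ModEq]
  set x : ℕ → ℕ := fun j => d * p ^ j % (2 * m) with hx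
  have hxlt : ∀ j, x j < 2 * m := fun j => Nat.mod_lt _ (by omega)
  have hxcop : ∀ j, (x j).Coprime (2 * m) := by
    intro j
    have : (d * p ^ j).Coprime (2 * m) := Nat.Coprime.mul_left hd (hcop.symm.pow_left j)
    exact (Nat.mod_modEq _ _).gcd_eq.trans this
  have hxone : ∀ j c, x j * c = 2 * m → x j = 1 := fun j c hc =>
    Nat.Coprime.eq_one_of_dvd (hxcop j) ⟨c, hc.symm⟩
  have hxsucc : ∀ j, x (j + 1) = p * x j % (2 * m) := by
    intro j
    simp only [hx, pow_succ']
    rw [Nat.mul_mod p, Nat.mod_mod, ← Nat.mul_mod]; congr 1; ring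
  have hle : ∀ j i, i ≤ h → i * x j ≤ m := by
    intro j i
    induction i with
    | zero => intro; omega
    | succ i ih =>
      intro hi
      have h1 := ih (by omega)
      have h2 : x j ≤ m := by
        have := hsmall j 1 (by omega)
        simpa [hx] using this
      have h3 := hsmall j (i + 1) hi
      rw [Nat.mul_mod, Nat.mod_eq_of_lt (show i + 1 < 2 * m by omega)] at h3
      change x j * (i + 1) % (2 * m) ≤ m at h3
      have h4 : x j * (i + 1) ≤ 2 * m := by nlinarith
      rcases h4.eq_or_lt with h5 | h5
      · have := hxone j _ h5
        rw [this] at h5; omega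
      · rw [Nat.mod_eq_of_lt h5] at h3
        linarith
  have hstep : ∀ j, x j < p ^ (k - 1) → x (j + 1) = p * x j := by
    intro j hj
    rw [hxsucc]
    apply Nat.mod_eq_of_lt
    have h1 : p * x j ≤ 2 * m := by
      have : p * x j < p * p ^ (k - 1) := by
        apply Nat.mul_lt_mul_of_pos_left hj; omega
      omega
    refine lt_of_le_of_ne h1 fun h2 => ?_
    have := hxone j p (by linarith)
    rw [this] at h2; omega
  obtain ⟨j, hj⟩ : ∃ j, p ^ (k - 1) ≤ x j := by
    by_contra! hcon
    have hall : ∀ j, x j = p ^ j * x 0 := by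
      intro j
      induction j with
      | zero => simp
      | succ j ih => rw [hstep j (hcon j), ih]; ring
    have h0 : x 0 ≠ 0 := by
      intro h0
      have := hxcop 0
      rw [h0, Nat.coprime_zero_left] at this
      omega
    have h1 := hall k
    have h2 := hxlt k
    have h3 : p ^ k * 1 ≤ p ^ k * x 0 := Nat.mul_le_mul_left _ (by omega)
    omega
  have hnot : ∀ s, 0 < s → s < k → x (j + s) < p ^ (k - 1) := by
    intro s hs hsk
    by_contra! hcon
    have h1 := hpair j s hs hsk
    have h2 : d * p ^ j * (h * (1 + p ^ s)) ≡ h * x j + h * x (j + s) [MOD 2 * m] := by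
      have e1 : x j ≡ d * p ^ j [MOD 2 * m] := Nat.mod_modEq _ _
      have e2 : x (j + s) ≡ d * p ^ (j + s) [MOD 2 * m] := Nat.mod_modEq _ _
      have e3 := ((e1.mul_left h).add (e2.mul_left h)).symm
      convert e3 using 1
      ring
    rw [h2] at h1
    have h3 := hle j h le_rfl
    have h4 := hle (j + s) h le_rfl
    have h5 : h * p ^ (k - 1) ≤ h * x j := Nat.mul_le_mul_left _ hj
    have h6 : h * p ^ (k - 1) ≤ h * x (j + s) := Nat.mul_le_mul_left _ hcon
    have h7 : m < 2 * (h * p ^ (k - 1)) := by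
      have : p * p ^ (k - 1) = 2 * (h * p ^ (k - 1)) + p ^ (k - 1) := by rw [hpdef]; ring
      have : p ^ (k - 1) ≤ h * p ^ (k - 1) := Nat.le_mul_of_pos_left _ (by omega)
      omega
    rcases lt_or_ge (h * x j + h * x (j + s)) (2 * m) with h8 | h8
    · rw [Nat.mod_eq_of_lt h8] at h1; omega
    · have h9 : h * x j = m := by omega
      have := hxone j (2 * h) (by linarith)
      omega
  have hfirst : x (j + 1) = p * x j - 2 * m := by
    rw [hxsucc]
    have h1 := hle j h le_rfl
    have h2 : p * x j = 2 * (h * x j) + x j := by rw [hpdef]; ring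
    have h3 : p * p ^ (k - 1) ≤ p * x j := Nat.mul_le_mul_left _ hj
    have h4 := hxlt j
    rw [Nat.mod_eq_sub_mod (by omega), Nat.mod_eq_of_lt (by omega)]
  have hiter : ∀ t, t + 1 ≤ k → x (j + (t + 1)) = p ^ t * (p * x j - 2 * m) := by
    intro t
    induction t with
    | zero => intro; simpa using hfirst
    | succ t ih =>
      intro ht
      rw [← add_assoc, hstep _ (hnot (t + 1) (by omega) (by omega)), ih (by omega)]; ring
  have hlast := hiter (k - 1) (by omega)
  rw [show k - 1 + 1 = k by omega] at hlast
  have hper : x (j + k) = x j := by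
    change d * p ^ (j + k) ≡ d * p ^ j [MOD 2 * m]
    have := hkmod.mul_left (d * p ^ j)
    rw [mul_one] at this
    convert this using 1
    ring
  have hval : x j = p ^ (k - 1) := by
    rw [hper] at hlast
    have h3 : p * p ^ (k - 1) ≤ p * x j := Nat.mul_le_mul_left _ hj
    have h1 : 2 * m ≤ p * x j := by omega
    zify [h1] at hlast hm hpk
    have h5 : (x j : ℤ) * (2 * m) = (p : ℤ) ^ (k - 1) * (2 * m) := by
      have : (p : ℤ) ^ (k - 1) * (p * x j) = (2 * m + 1) * x j := by rw [← hm, hpk]; ring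
      linarith
    have h6 : (2 * m : ℤ) ≠ 0 := by exact_mod_cast (show 2 * m ≠ 0 by omega)
    exact_mod_cast mul_right_cancel₀ h6 h5
  have hmod : d ≡ p ^ (k - 1 + j * (k - 1)) [MOD 2 * m] := by
    have h1 : d * p ^ j ≡ p ^ (k - 1) [MOD 2 * m] := by
      rw [← hval]; exact (Nat.mod_modEq _ _).symm
    have h2 := h1.mul_right (p ^ (j * (k - 1)))
    rw [← pow_add, mul_assoc, ← pow_add] at h2
    have h3 : j + j * (k - 1) = k * j := by
      obtain ⟨l, rfl⟩ : ∃ l, k = l + 1 := ⟨k - 1, by omega⟩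
      simp; ring
    rw [h3, pow_mul] at h2
    have h4 := (hkmod.pow j).mul_left d
    rw [one_pow, mul_one] at h4
    exact h4.symm.trans h2
  generalize k - 1 + j * (k - 1) = e at hmod
  refine ⟨e % k, Nat.mod_lt _ (by omega), hmod.trans ?_⟩
  have h1 := (hkmod.pow (e / k)).mul_left (p ^ (e % k))
  rw [one_pow, mul_one, ← pow_mul, ← pow_add, Nat.mod_add_div] at h1
  exact h1

theorem mod_le_half_of_pow_sub_one_pow_eq {F : Type*} [Field F] [Fintype F] {p d i : ℕ} [CharP F p]
    (hd : ∀ x : F, (x ^ d - 1) ^ ((Fintype.card F - 1) / 2) = (x - 1) ^ ((Fintype.card F - 1) / 2))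
    (hcop : d.Coprime (Fintype.card F - 1)) (hcard : 3 ≤ Fintype.card F)
    (hi : ¬ p ∣ ((Fintype.card F - 1) / 2).choose i) :
    d * i % (Fintype.card F - 1) ≤ (Fintype.card F - 1) / 2 := by
  classical
  set N := Fintype.card F - 1 with hN
  set m := N / 2 with hm
  by_contra! hlt
  have him : i ≤ m := by
    by_contra! h
    exact hi (by simp [Nat.choose_eq_zero_of_lt h])
  set e := d * i % N with he
  have heN : e < N := Nat.mod_lt _ (by omega)
  have key : ∀ c : ℕ, ∑ x : Fˣ, (x : F) ^ (N - e) * ((x : F) ^ c - 1) ^ m =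
      ∑ j ∈ range (m + 1), (-1) ^ (m - j) * (m.choose j : F) * if N ∣ c * j + (N - e) then -1 else 0 := by
    intro c
    simp_rw [sub_eq_add_neg _ (1 : F), add_pow, mul_sum]
    rw [sum_comm]
    refine sum_congr rfl fun j _ => ?_
    rw [hN, ← FiniteField.sum_pow_units F, mul_sum]
    refine sum_congr rfl fun x _ => ?_
    rw [pow_add, pow_mul]; ring
  have h1 : ∑ x : Fˣ, (x : F) ^ (N - e) * ((x : F) ^ d - 1) ^ m =
      ∑ x : Fˣ, (x : F) ^ (N - e) * ((x : F) ^ 1 - 1) ^ m := by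
    simp_rw [hd, pow_one]
  rw [key, key, sum_eq_single i, sum_eq_zero] at h1
  · rw [if_pos] at h1
    · have : (m.choose i : F) ≠ 0 := by rwa [Ne, CharP.cast_eq_zero_iff F p]
      simp [this] at h1
    · have : d * i + (N - e) = N * (d * i / N + 1) := by
        have := Nat.div_add_mod (d * i) N
        rw [mul_add]; omega
      exact ⟨_, this⟩
  · intro j hj
    rw [mem_range] at hj
    rw [if_neg, mul_zero]
    rintro ⟨c, hc⟩
    have : 0 < 1 * j + (N - e) := by omega
    have h2 : 1 * j + (N - e) < N := by omega
    exact Nat.not_dvd_of_pos_of_lt this h2 ⟨c, hc⟩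
  · intro j hj hji
    rw [mem_range] at hj
    rw [if_neg, mul_zero]
    intro hdvd
    apply hji
    have h2 : d * j ≡ d * i [MOD N] := by
      have h3 : d * j + (N - e) ≡ d * i + (N - e) [MOD N] := by
        refine ((Nat.modEq_zero_iff_dvd).2 hdvd).trans (Nat.ModEq.symm ((Nat.modEq_zero_iff_dvd).2 ?_))
        have : d * i + (N - e) = N * (d * i / N + 1) := by
          have := Nat.div_add_mod (d * i) N
          rw [mul_add]; omega
        exact ⟨_, this⟩
      exact Nat.ModEq.add_right_cancel' _ h3
    have h4 := Nat.ModEq.cancel_left_of_coprime (Nat.coprime_comm.1 hcop) h2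
    exact Nat.ModEq.eq_of_lt_of_lt h4 (by omega) (by omega)
  · intro h
    simp at h; omega

/-- A power map preserving the quadratic character of `x - 1` is a power of Frobenius. -/
theorem exists_pow_eq_frobenius_of_quadraticChar {F : Type*} [Field F] [Fintype F] [DecidableEq F]
    {p k d : ℕ} [hp : Fact p.Prime] (hodd : Odd p) (hk : 2 ≤ k) (hcard : Fintype.card F = p ^ k)
    (hd : ∀ x : F, quadraticChar F (x ^ d - 1) = quadraticChar F (x - 1)) :
    ∃ j < k, ∀ x : F, x ^ d = x ^ p ^ j := by
  have hchar : CharP F p := by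
    have h1 : (p : F) = 0 := by
      have h2 : ((p ^ k : ℕ) : F) = 0 := by rw [← hcard]; exact Nat.cast_card_eq_zero F
      rw [Nat.cast_pow] at h2
      exact eq_zero_of_pow_eq_zero h2
    exact (CharP.charP_iff_prime_eq_zero hp.out).2 h1
  have hp3 : 3 ≤ p := by
    have := hp.out.two_le
    obtain ⟨h, rfl⟩ := hodd
    omega
  have hchar2 : ringChar F ≠ 2 := by
    rw [ringChar.eq F p]; omega
  have hpk : 3 ≤ p ^ k := hp3.trans (Nat.le_self_pow (by omega) p)
  have hhalf : Fintype.card F / 2 = (p ^ k - 1) / 2 := by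
    obtain ⟨m, hm⟩ : Odd (p ^ k) := hodd.pow
    omega
  have hcop : d.Coprime (p ^ k - 1) := by
    obtain ⟨g, hg⟩ := IsCyclic.exists_generator (α := Fˣ)
    have hord : orderOf g = p ^ k - 1 := by
      rw [orderOf_eq_card_of_forall_mem_zpowers hg, Nat.card_eq_fintype_card, Fintype.card_units,
        hcard]
    obtain ⟨c, hc⟩ := Nat.gcd_dvd_right d (p ^ k - 1)
    obtain ⟨c', hc'⟩ := Nat.gcd_dvd_left d (p ^ k - 1)
    set t := d.gcd (p ^ k - 1)
    have h1 : (g ^ c) ^ d = 1 := by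
      rw [← pow_mul, ← orderOf_dvd_iff_pow_eq_one, hord]
      exact ⟨c', by rw [hc', hc]; ring⟩
    have h2 : g ^ c = 1 := by
      have h3 := hd (g ^ c : Fˣ)
      rw [← Units.val_pow_eq_pow_val, h1, Units.val_one, sub_self, quadraticChar_zero, eq_comm,
        quadraticChar_eq_zero_iff, sub_eq_zero] at h3
      exact Units.ext h3
    rw [← orderOf_dvd_iff_pow_eq_one, hord] at h2
    have hc0 : 0 < c := by
      rcases Nat.eq_zero_or_pos c with h | h
      · rw [h] at hc; omega
      · exact h
    have h4 := Nat.le_of_dvd hc0 h2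
    have h5 : t * c ≤ 1 * c := by omega
    have h6 := Nat.le_of_mul_le_mul_right h5 hc0
    have h7 : t ≠ 0 := by rintro h; rw [h] at hc; omega
    change t = 1
    omega
  have hpow : ∀ j, ∀ x : F, (x ^ (d * p ^ j) - 1) ^ ((p ^ k - 1) / 2) =
      (x - 1) ^ ((p ^ k - 1) / 2) := by
    have hchi : ∀ a : F, a ^ ((p ^ k - 1) / 2) = (quadraticChar F a : F) := by
      intro a
      rw [quadraticChar_eq_pow_of_char_ne_two' hchar2, hhalf]
    intro j
    induction j with
    | zero => intro x; rw [hchi, hchi, pow_zero, mul_one, hd]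
    | succ j ih =>
      intro x
      have h1 : x ^ (d * p ^ (j + 1)) - 1 = (x ^ (d * p ^ j) - 1) ^ p := by
        rw [sub_pow_char, one_pow, pow_succ, ← mul_assoc, pow_mul x]
      rw [h1, ← pow_mul, Nat.mul_comm p, pow_mul, ih, hchi]
      rcases eq_or_ne (x - 1) 0 with h | h
      · simp [h, hp.out.ne_zero]
      · rcases quadraticChar_dichotomy h with h | h <;> simp [h, hodd.neg_one_pow]
  have hcopj : ∀ j, (d * p ^ j).Coprime (p ^ k - 1) := by
    intro j
    refine Nat.Coprime.mul_left hcop (Nat.Coprime.pow_left j ?_)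
    refine Nat.Coprime.coprime_dvd_left (dvd_pow_self p (show k ≠ 0 by omega)) ?_
    have : Nat.Coprime (p ^ k - 1 + 1) (p ^ k - 1) := by simp
    rwa [Nat.sub_add_cancel (by omega)] at this
  have hmod : ∀ j i, ¬ p ∣ ((p ^ k - 1) / 2).choose i →
      d * p ^ j * i % (p ^ k - 1) ≤ (p ^ k - 1) / 2 := by
    intro j i hi
    have := mod_le_half_of_pow_sub_one_pow_eq (F := F) (p := p) (d := d * p ^ j) (i := i)
    rw [hcard] at this
    exact this (hpow j) (hcopj j) hpk hi
  obtain ⟨j, hj, hdj⟩ := exists_eq_pow_of_mod_le_half hp3 hodd hk hcop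
    (fun j i hi => hmod j i (not_dvd_choose_half hodd (by omega) hi))
    (fun j s hs hsk => hmod j _ fun hdvd => by
      rw [(choose_half_modEq_one hodd hs hsk).dvd_iff dvd_rfl] at hdvd
      exact hp.out.one_lt.ne' (Nat.dvd_one.1 hdvd))
  refine ⟨j, hj, fun x => ?_⟩
  rcases eq_or_ne x 0 with rfl | hx
  · have hd0 : d ≠ 0 := by
      rintro rfl
      rw [Nat.coprime_zero_left] at hcop
      omega
    rw [zero_pow hd0, zero_pow (pow_ne_zero _ hp.out.ne_zero)]
  · have h1 : orderOf (Units.mk0 x hx) ∣ p ^ k - 1 := by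
      rw [← hcard, ← Fintype.card_units]; exact orderOf_dvd_card
    have h2 := pow_eq_pow_iff_modEq.2 (hdj.of_dvd h1)
    simpa using congrArg Units.val h2

section QuadraticCharacter

variable {F : Type*} [Field F] [Fintype F] [DecidableEq F]

theorem sum_quadraticChar_sub_mul_sub (hF : ringChar F ≠ 2) {a b : F} (hab : a ≠ b) :
    ∑ x : F, quadraticChar F (x - a) * quadraticChar F (x - b) = -1 := by
  have hba : b - a ≠ 0 := sub_ne_zero.2 hab.symm
  have hsq := quadraticChar_sq_one hba
  have hneg := quadraticChar_sq_one (neg_ne_zero.2 (one_ne_zero (α := F)))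
  have hj := jacobiSum_nontrivial_inv (quadraticChar_ne_one hF)
  rw [(quadraticChar_isQuadratic F).inv, jacobiSum] at hj
  rw [← ((Equiv.mulLeft₀ (b - a) hba).trans (Equiv.addLeft a)).sum_comp]
  calc _ = ∑ y : F, quadraticChar F (-1) * (quadraticChar F y * quadraticChar F (1 - y)) := by
        refine sum_congr rfl fun y _ => ?_
        have h1 : a + (b - a) * y - a = (b - a) * y := by ring
        have h2 : a + (b - a) * y - b = (b - a) * (-1 * (1 - y)) := by ring
        simp only [Equiv.trans_apply, Equiv.mulLeft₀_apply, Equiv.coe_addLeft, h1, h2, map_mul]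
        linear_combination (quadraticChar F (-1) * quadraticChar F y * quadraticChar F (1 - y)) * hsq
    _ = -1 := by
        rw [← mul_sum, hj]
        linear_combination -hneg

theorem sum_quadraticChar_sub (hF : ringChar F ≠ 2) (a : F) :
    ∑ x : F, quadraticChar F (x - a) = 0 := by
  rw [← quadraticChar_sum_zero hF]
  exact (Equiv.subRight a).sum_comp (fun x => quadraticChar F x)

theorem sum_quadraticChar_sub_sq (a : F) :
    ∑ x : F, quadraticChar F (x - a) * quadraticChar F (x - a) = Fintype.card F - 1 := by
  rw [← sum_erase_add univ _ (mem_univ a)]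
  have : ∀ x ∈ univ.erase a, quadraticChar F (x - a) * quadraticChar F (x - a) = 1 := by
    intro x hx
    rw [← sq]
    exact quadraticChar_sq_one (sub_ne_zero.2 (ne_of_mem_erase hx))
  rw [sum_congr rfl this, sub_self, quadraticChar_zero, sum_const, card_erase_of_mem (mem_univ a),
    card_univ]
  have := Fintype.card_pos (α := F)
  simp; omega

/-- In the Paley graph of order `r ^ 2`, a vertex adjacent to all but one of the vertices of a
clique of size `r` is the remaining vertex of this clique. -/
theorem eq_of_adj_erase_clique (hF : ringChar F ≠ 2) {r : ℕ} (hr : 2 ≤ r)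
    (hcard : Fintype.card F = r ^ 2) {T : Finset F} (hT : #T = r)
    (hclique : ∀ x ∈ T, ∀ y ∈ T, x ≠ y → quadraticChar F (x - y) = 1)
    {t z : F} (ht : t ∈ T) (hz : ∀ x ∈ T, x ≠ t → quadraticChar F (z - x) = 1) : z = t := by
  set g : F → ℤ := fun x => ∑ y ∈ T, quadraticChar F (x - y) with hg
  have hgT : ∀ x ∈ T, g x = r - 1 := by
    intro x hx
    rw [hg, ← hT]
    simp only
    rw [← sum_erase_add _ _ hx, sub_self, quadraticChar_zero,
      sum_congr rfl fun y hy => hclique x hx y (mem_of_mem_erase hy) (ne_of_mem_erase hy).symm,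
      sum_const, card_erase_of_mem hx]
    simp; omega
  have hsum : ∑ x, g x = 0 := by
    simp only [hg]
    rw [sum_comm, sum_eq_zero]
    exact fun y _ => sum_quadraticChar_sub hF y
  have hsumsq : ∑ x, g x * g x = r * (r ^ 2 - r) := by
    simp only [hg, sum_mul_sum]
    rw [sum_comm]
    have : ∀ y ∈ T, ∑ x : F, ∑ y' ∈ T, quadraticChar F (x - y) * quadraticChar F (x - y') =
        r ^ 2 - r := by
      intro y hy
      rw [sum_comm, ← sum_erase_add _ _ hy, sum_quadraticChar_sub_sq,
        sum_congr rfl fun y' hy' => sum_quadraticChar_sub_mul_sub hF (ne_of_mem_erase hy').symm,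
        sum_const, card_erase_of_mem hy, hT, hcard]
      rw [nsmul_eq_mul, Nat.cast_sub (by omega)]
      push_cast
      ring
    rw [sum_congr rfl this, sum_const, hT]
    simp
  have hall : ∑ x, (g x + 1) ^ 2 = (r : ℤ) * ((r : ℤ) ^ 2 - r) + (r : ℤ) ^ 2 := by
    have : ∀ x ∈ univ, (g x + 1) ^ 2 = g x * g x + 2 * g x + 1 := fun x _ => by ring
    rw [sum_congr rfl this, sum_add_distrib, sum_add_distrib, ← mul_sum, hsum, hsumsq]
    simp [hcard]
  have hin : ∑ x ∈ T, (g x + 1) ^ 2 = (r : ℤ) * (r : ℤ) ^ 2 := by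
    rw [sum_congr rfl fun x hx => by rw [hgT x hx, sub_add_cancel], sum_const, hT]
    simp
  have hout : ∑ x ∈ univ \ T, (g x + 1) ^ 2 = 0 := by
    have := sum_sdiff (f := fun x => (g x + 1) ^ 2) (subset_univ T)
    rw [hall, hin] at this
    linear_combination this
  have hzT : z ∈ T := by
    by_contra hzT
    have h1 := (sum_eq_zero_iff_of_nonneg fun x _ => sq_nonneg (g x + 1)).1 hout z (by simp [hzT])
    have h2 : g z = (r - 1) + quadraticChar F (z - t) := by
      rw [hg, ← hT]
      simp only
      rw [← sum_erase_add _ _ ht,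
        sum_congr rfl fun y hy => hz y (mem_of_mem_erase hy) (ne_of_mem_erase hy),
        sum_const, card_erase_of_mem ht]
      simp; omega
    have h3 : z - t ≠ 0 := by
      rintro h
      exact hzT (by rwa [sub_eq_zero.1 h])
    have h4 : g z = -1 := by linarith [pow_eq_zero_iff (two_ne_zero) |>.1 h1]
    rcases quadraticChar_dichotomy h3 with h | h <;> rw [h] at h2 <;> omega
  by_contra hne
  have := hz z hzT hne
  rw [sub_self, quadraticChar_zero] at this
  exact zero_ne_one this

/-- Two elements of the same quadratic character `e` are equal if their translates have the same
quadratic character at all points of quadratic character `-e`. -/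
theorem eq_of_quadraticChar_sub_eq (hF : ringChar F ≠ 2) {e : ℤ} {a b : F}
    (he : e ^ 2 = 1) (ha : quadraticChar F a = e) (hb : quadraticChar F b = e)
    (hab : ∀ x, quadraticChar F x = -e → quadraticChar F (x - a) = quadraticChar F (x - b)) :
    a = b := by
  by_contra hne
  have he0 : e ≠ 0 := by rintro rfl; simp at he
  have h1 : ∑ x : F, (quadraticChar F (x - a) * quadraticChar F (x - b) + e * quadraticChar F x)
      = -1 := by
    rw [sum_add_distrib, sum_quadraticChar_sub_mul_sub hF hne, ← mul_sum, quadraticChar_sum_zero hF]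
    simp
  have h2 : 0 ≤ ∑ x : F,
      (quadraticChar F (x - a) * quadraticChar F (x - b) + e * quadraticChar F x) := by
    refine sum_nonneg fun x _ => ?_
    have hlow : ∀ u v : F, -1 ≤ quadraticChar F u * quadraticChar F v := by
      intro u v
      rw [← map_mul]
      rcases eq_or_ne (u * v) 0 with h | h
      · simp [h]
      · rcases quadraticChar_dichotomy h with h | h <;> simp [h]
    rcases eq_or_ne x 0 with rfl | hx
    · rw [zero_sub, zero_sub, ← map_mul, neg_mul_neg, map_mul, ha, hb, quadraticChar_zero]
      nlinarith
    · have h3 : quadraticChar F x = e ∨ quadraticChar F x = -e :=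
        sq_eq_sq_iff_eq_or_eq_neg.1 (by rw [quadraticChar_sq_one hx, he])
      rcases h3 with h | h
      · rw [h]; nlinarith [hlow (x - a) (x - b)]
      · have h4 : x - b ≠ 0 := by
          intro h0
          rw [sub_eq_zero.1 h0, hb] at h
          exact he0 (by linarith)
        rw [hab x h, h]
        nlinarith [quadraticChar_sq_one h4]
  omega

theorem exists_quadraticChar_sub_eq_neg_one (hF : ringChar F ≠ 2) {b : F} (hb : b ≠ 0) :
    ∃ a, quadraticChar F a = 1 ∧ quadraticChar F (a - b) ≠ 1 := by
  by_contra! hcon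
  have h1 : ∑ x : F, (quadraticChar F (x - 0) * quadraticChar F (x - b) + quadraticChar F (x - b))
      = -1 := by
    rw [sum_add_distrib, sum_quadraticChar_sub_mul_sub hF hb.symm, sum_quadraticChar_sub hF,
      add_zero]
  have h2 : ∑ x : F, ((if x = 0 then -1 else 0) + if x = 1 then 2 else 0) ≤ ∑ x : F,
      (quadraticChar F (x - 0) * quadraticChar F (x - b) + quadraticChar F (x - b)) := by
    refine sum_le_sum fun x _ => ?_
    rw [sub_zero]
    rcases eq_or_ne x 0 with rfl | hx
    · rcases quadraticChar_dichotomy (neg_ne_zero.2 hb) with h | h <;> simp [h]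
    · rcases quadraticChar_dichotomy hx with h | h
      · rw [h, hcon x h, if_neg hx]
        split_ifs <;> norm_num
      · have hx1 : x ≠ 1 := by
          rintro rfl
          simp at h
        simp [h, hx, hx1]
  rw [h1, sum_add_distrib] at h2
  simp at h2

/-- A subfield of order `r` is a clique in the Paley graph of order `r ^ 2`. -/
theorem exists_clique_card_eq_sqrt {p n r : ℕ} [hp : Fact p.Prime] [CharP F p] (hodd : Odd p)
    (hn : 0 < n) (hr : r = p ^ n) (hcard : Fintype.card F = r ^ 2) :
    ∃ K : Finset F, #K = r ∧ 0 ∈ K ∧ 1 ∈ K ∧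
      ∀ x ∈ K, ∀ y ∈ K, x ≠ y → quadraticChar F (x - y) = 1 := by
  have hF : ringChar F ≠ 2 := by
    rw [ringChar.eq F p]
    rintro rfl
    exact absurd hodd (by decide)
  have hr2 : 2 ≤ r := by
    rw [hr]
    exact hp.out.two_le.trans (Nat.le_self_pow hn.ne' p)
  obtain ⟨h, hh⟩ : Odd r := hr ▸ hodd.pow
  obtain ⟨g, hg⟩ := IsCyclic.exists_generator (α := Fˣ)
  have hord : orderOf g = r ^ 2 - 1 := by
    rw [orderOf_eq_card_of_forall_mem_zpowers hg, Nat.card_eq_fintype_card, Fintype.card_units,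
      hcard]
  have hfac : r ^ 2 - 1 = (r + 1) * (r - 1) := by
    simpa using Nat.sq_sub_sq r 1
  have hprim : IsPrimitiveRoot ((g : F) ^ (r + 1)) (r - 1) := by
    have h1 : IsPrimitiveRoot (g : F) (r ^ 2 - 1) := by
      rw [← hord, ← orderOf_units]
      exact IsPrimitiveRoot.orderOf _
    exact h1.pow (by rw [hfac]; exact Nat.mul_pos (by omega) (by omega)) hfac
  have hmem : ∀ x ∈ insert 0 (Polynomial.nthRootsFinset (r - 1) (1 : F)), x ^ r = x := by
    intro x hx
    rw [mem_insert, Polynomial.mem_nthRootsFinset (by omega)] at hx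
    rcases hx with rfl | hx
    · exact zero_pow (by omega)
    · rw [show r = r - 1 + 1 by omega, pow_succ, hx, one_mul]
  refine ⟨insert 0 (Polynomial.nthRootsFinset (r - 1) (1 : F)), ?_, by simp, ?_, ?_⟩
  · rw [card_insert_of_notMem, hprim.card_nthRootsFinset]
    · omega
    · rw [Polynomial.mem_nthRootsFinset (by omega), zero_pow (by omega)]
      exact zero_ne_one
  · rw [mem_insert, Polynomial.mem_nthRootsFinset (by omega)]
    simp
  · intro x hx y hy hxy
    have hne := sub_ne_zero.2 hxy
    have h1 : (x - y) ^ r = x - y := by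
      have h2 := hmem x hx
      have h3 := hmem y hy
      rw [hr] at h2 h3 ⊢
      rw [sub_pow_char_pow, h2, h3]
    have h4 : (x - y) ^ (r - 1) = 1 := by
      apply mul_right_cancel₀ hne
      rw [← pow_succ, show r - 1 + 1 = r by omega, h1, one_mul]
    have h5 : (quadraticChar F (x - y) : F) = 1 := by
      rw [quadraticChar_eq_pow_of_char_ne_two' hF, hcard]
      have : r ^ 2 / 2 = (r - 1) * (h + 1) := by
        have : r ^ 2 = 2 * ((r - 1) * (h + 1)) + 1 := by
          rw [hh]; simp; ring
        omega
      rw [this, pow_mul, h4, one_pow]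
    rcases quadraticChar_dichotomy hne with h6 | h6
    · exact h6
    · rw [h6] at h5
      exact absurd (by simpa using h5) (Ring.neg_one_ne_one_of_char_ne_two hF)

end QuadraticCharacter

section Preserver

theorem exists_eq_pow_of_map_mul {F : Type*} [Field F] [Finite F] {f : F → F} (h1 : f 1 = 1)
    (h0 : ∀ x, x ≠ 0 → f x ≠ 0) (hmul : ∀ x y, x ≠ 0 → y ≠ 0 → f (x * y) = f x * f y) :
    ∃ n : ℕ, ∀ x, x ≠ 0 → f x = x ^ n := by
  obtain ⟨g, hg⟩ := IsCyclic.exists_monoid_generator (α := Fˣ)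
  obtain ⟨n, hn⟩ := hg (Units.mk0 (f g) (h0 g g.ne_zero))
  have hn' : (g : F) ^ n = f g := by simpa using congrArg Units.val hn
  refine ⟨n, fun x hx => ?_⟩
  obtain ⟨l, hl⟩ := hg (Units.mk0 x hx)
  have hl' : (g : F) ^ l = x := by simpa using congrArg Units.val hl
  rw [← hl']
  clear hl hl'
  induction l with
  | zero => simp [h1]
  | succ l ih =>
    rw [pow_succ, hmul _ _ (pow_ne_zero _ g.ne_zero) g.ne_zero, ih, mul_pow, hn']

variable {F : Type*} [Field F] [Fintype F] [DecidableEq F]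

/-- A map `f` with `f 1 = 1` that preserves positivity of `2 × 2` matrices over a finite field of
odd square order in which `-1` and `2` are squares, with a clique `K` of the Paley graph whose size
is the square root of the order. -/
structure IsNormalizedPreserver (f : F → F) (K : Finset F) : Prop where
  ringChar_ne : ringChar F ≠ 2
  neg_one : quadraticChar F (-1) = 1
  two : quadraticChar F 2 = 1
  card_eq : Fintype.card F = #K ^ 2
  two_le : 2 ≤ #K
  zero_mem : 0 ∈ K
  one_mem : 1 ∈ K
  clique : ∀ x ∈ K, ∀ y ∈ K, x ≠ y → quadraticChar F (x - y) = 1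
  map_one : f 1 = 1
  pos : ∀ a, quadraticChar F a = 1 → quadraticChar F (f a) = 1
  minor : ∀ a b c, quadraticChar F a = 1 → quadraticChar F (a * c - b ^ 2) = 1 →
    quadraticChar F (f a * f c - f b ^ 2) = 1

theorem ne_zero_of_quadraticChar_eq_one {a : F} (ha : quadraticChar F a = 1) : a ≠ 0 := by
  rintro rfl
  simp at ha

namespace IsNormalizedPreserver

variable {f : F → F} {K : Finset F}

theorem quadraticChar_sub_comm (h : IsNormalizedPreserver f K) (x y : F) :
    quadraticChar F (x - y) = quadraticChar F (y - x) := by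
  rw [← neg_sub, neg_eq_neg_one_mul, map_mul, h.neg_one, one_mul]

theorem map_sub_eq_one (h : IsNormalizedPreserver f K) {a b : F} (hb : quadraticChar F b = 1)
    (hab : quadraticChar F (a - b) = 1) : quadraticChar F (f a - f b) = 1 := by
  have h1 := h.minor b b a hb (by
    rw [show b * a - b ^ 2 = b * (a - b) by ring, map_mul, hb, hab, one_mul])
  rwa [show f b * f a - f b ^ 2 = f b * (f a - f b) by ring, map_mul, h.pos b hb, one_mul] at h1

theorem mul_map_sub_eq_one (h : IsNormalizedPreserver f K) {a b : F} (ha : quadraticChar F a = 1)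
    (hb : quadraticChar F b = -1) (hab : quadraticChar F (a - b) = -1) :
    quadraticChar F (f b) * quadraticChar F (f a - f b) = 1 := by
  have h1 := h.minor a b b ha (by
    rw [show a * b - b ^ 2 = b * (a - b) by ring, map_mul, hb, hab]; norm_num)
  rwa [show f a * f b - f b ^ 2 = f b * (f a - f b) by ring, map_mul] at h1

theorem eq_of_adj_image (h : IsNormalizedPreserver f K) {u a t z : F}
    (hu : quadraticChar F u = 1) (ha : quadraticChar F a = 1) (ht : t ∈ K)
    (hz : ∀ x ∈ K, x ≠ t → quadraticChar F (z - if x = 0 then 0 else a * f (u * x)) = 1) :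
    z = if t = 0 then 0 else a * f (u * t) := by
  set φ : F → F := fun x => if x = 0 then 0 else a * f (u * x) with hφ
  have hpos : ∀ x ∈ K, x ≠ 0 → quadraticChar F (u * x) = 1 := by
    intro x hx hx0
    have := h.clique x hx 0 h.zero_mem hx0
    rw [sub_zero] at this
    rw [map_mul, hu, this, one_mul]
  have hadj : ∀ x ∈ K, ∀ y ∈ K, x ≠ y → quadraticChar F (φ x - φ y) = 1 := by
    intro x hx y hy hxy
    by_cases hx0 : x = 0
    · have hy0 : y ≠ 0 := fun hy0 => hxy (hx0.trans hy0.symm)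
      simp only [hφ]
      rw [if_pos hx0, if_neg hy0, h.quadraticChar_sub_comm, sub_zero, map_mul, ha,
        h.pos _ (hpos y hy hy0), one_mul]
    · by_cases hy0 : y = 0
      · simp only [hφ]
        rw [if_pos hy0, if_neg hx0, sub_zero, map_mul, ha, h.pos _ (hpos x hx hx0), one_mul]
      · simp only [hφ]
        rw [if_neg hx0, if_neg hy0, ← mul_sub, map_mul, ha, one_mul]
        apply h.map_sub_eq_one (hpos y hy hy0)
        rw [← mul_sub, map_mul, hu, h.clique x hx y hy hxy, one_mul]
  have hinj : Set.InjOn φ K := by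
    intro x hx y hy hxy
    by_contra hne
    have := hadj x hx y hy hne
    rw [hxy, sub_self, quadraticChar_zero] at this
    exact zero_ne_one this
  refine eq_of_adj_erase_clique h.ringChar_ne h.two_le h.card_eq (T := K.image φ)
    (card_image_of_injOn hinj) ?_ (mem_image_of_mem φ ht) ?_
  · simp only [mem_image]
    rintro _ ⟨x, hx, rfl⟩ _ ⟨y, hy, rfl⟩ hxy
    exact hadj x hx y hy fun hxy' => hxy (congrArg φ hxy')
  · simp only [mem_image]
    rintro _ ⟨x, hx, rfl⟩ hxt
    exact hz x hx fun hxt' => hxt (congrArg φ hxt')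

theorem map_zero (h : IsNormalizedPreserver f K) : f 0 = 0 := by
  have h1 : quadraticChar F (1 : F) = 1 := _root_.map_one _
  have := h.eq_of_adj_image (u := 1) (a := 1) (t := 0) (z := f 0 ^ 2) h1 h1 h.zero_mem (by
    intro x hx hx0
    have hx1 := h.clique x hx 0 h.zero_mem hx0
    have := h.minor 1 0 x h1 (by simpa using hx1)
    rwa [h.quadraticChar_sub_comm, if_neg hx0, one_mul, one_mul, ← one_mul (f x), ← h.map_one])
  rw [if_pos rfl] at this
  exact pow_eq_zero_iff two_ne_zero |>.1 this

theorem map_ne_zero (h : IsNormalizedPreserver f K) {b : F} (hb : b ≠ 0) : f b ≠ 0 := by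
  rcases quadraticChar_dichotomy hb with hb1 | hb1
  · exact ne_zero_of_quadraticChar_eq_one (h.pos b hb1)
  · obtain ⟨a, ha, hab⟩ := exists_quadraticChar_sub_eq_neg_one h.ringChar_ne hb
    have hne : a - b ≠ 0 := by
      intro h0
      rw [sub_eq_zero.1 h0, hb1] at ha
      norm_num at ha
    have := h.mul_map_sub_eq_one ha hb1 ((quadraticChar_dichotomy hne).resolve_left hab)
    intro h0
    simp [h0] at this

theorem map_mul_map_sq_div (h : IsNormalizedPreserver f K) {a b : F} (ha : quadraticChar F a = 1)
    (hb : b ≠ 0) : f a * f (b ^ 2 / a) = f b ^ 2 := by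
  have ha0 := ne_zero_of_quadraticChar_eq_one ha
  have hu : quadraticChar F (b ^ 2 / a) = 1 := by
    have : quadraticChar F (b ^ 2 / a) * quadraticChar F a = 1 := by
      rw [← map_mul, div_mul_cancel₀ _ ha0, quadraticChar_sq_one' hb]
    rwa [ha, mul_one] at this
  have := h.eq_of_adj_image (t := 1) (z := f b ^ 2) hu (h.pos a ha) h.one_mem (by
    intro x hx hx1
    split_ifs with hx0
    · rw [sub_zero, quadraticChar_sq_one' (h.map_ne_zero hb)]
    · rw [h.quadraticChar_sub_comm]
      apply h.minor a b _ ha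
      rw [show a * (b ^ 2 / a * x) - b ^ 2 = b ^ 2 * (x - 1) by field_simp, map_mul,
        quadraticChar_sq_one' hb, h.clique x hx 1 h.one_mem hx1, one_mul])
  rw [if_neg one_ne_zero, mul_one] at this
  exact this.symm

theorem map_sq (h : IsNormalizedPreserver f K) {b : F} (hb : b ≠ 0) : f (b ^ 2) = f b ^ 2 := by
  have := h.map_mul_map_sq_div (a := 1) (_root_.map_one _) hb
  rwa [div_one, h.map_one, one_mul] at this

theorem map_mul_of_sq (h : IsNormalizedPreserver f K) {a b : F} (ha : quadraticChar F a = 1)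
    (hb : quadraticChar F b = 1) : f (a * b) = f a * f b := by
  have ha0 := ne_zero_of_quadraticChar_eq_one ha
  have hb0 := ne_zero_of_quadraticChar_eq_one hb
  obtain ⟨x, rfl⟩ := (quadraticChar_one_iff_isSquare ha0).1 ha
  obtain ⟨y, rfl⟩ := (quadraticChar_one_iff_isSquare hb0).1 hb
  have hx := left_ne_zero_of_mul ha0
  have hy := left_ne_zero_of_mul hb0
  have h1 := h.map_mul_map_sq_div ha (mul_ne_zero hx hy)
  rw [← h.map_sq (mul_ne_zero hx hy)] at h1
  rw [show x * x * (y * y) = (x * y) ^ 2 by ring, ← h1]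
  congr 2
  field_simp

theorem quadraticChar_map (h : IsNormalizedPreserver f K) (b : F) :
    quadraticChar F (f b) = quadraticChar F b := by
  rcases eq_or_ne b 0 with rfl | hb
  · rw [h.map_zero]
  rcases quadraticChar_dichotomy hb with hb1 | hb1
  · rw [h.pos b hb1, hb1]
  have hneg1 : (-1 : F) ≠ 1 := Ring.neg_one_ne_one_of_char_ne_two h.ringChar_ne
  obtain ⟨n, hn⟩ := exists_eq_pow_of_map_mul (f := fun x => f (x ^ 2)) (by simp [h.map_one])
    (fun x hx => h.map_ne_zero (pow_ne_zero 2 hx)) (fun x y hx hy => by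
      rw [mul_pow, h.map_mul_of_sq (quadraticChar_sq_one' hx) (quadraticChar_sq_one' hy)])
  have hn2 : Even n := by
    by_contra hodd
    have := hn (-1) (by simp)
    rw [(Nat.not_even_iff_odd.1 hodd).neg_one_pow] at this
    simp only [even_two, Even.neg_pow, one_pow, h.map_one] at this
    exact hneg1 this.symm
  obtain ⟨c, rfl⟩ := hn2.two_dvd
  have hc : Odd c := by
    by_contra hc
    obtain ⟨i, hi⟩ := (quadraticChar_one_iff_isSquare (by simp)).1 h.neg_one
    have hi0 : i ≠ 0 := by
      rintro rfl
      simp at hi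
    have h1 := hn i hi0
    rw [pow_mul, sq, ← hi, (Nat.not_odd_iff_even.1 hc).neg_one_pow] at h1
    have h2 := h.map_sub_eq_one (a := 1) (b := -1) h.neg_one (by
      rw [sub_neg_eq_add, one_add_one_eq_two, h.two])
    rw [h1, h.map_one, sub_self, quadraticChar_zero] at h2
    exact zero_ne_one h2
  have h3 : f b ^ 2 = (b ^ c) ^ 2 := by
    rw [← h.map_sq hb, hn b hb, ← pow_mul, mul_comm]
  have h4 : quadraticChar F (b ^ c) = -1 := by rw [map_pow, hb1, hc.neg_one_pow]
  rcases sq_eq_sq_iff_eq_or_eq_neg.1 h3 with h5 | h5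
  · rw [h5, h4, hb1]
  · rw [h5, ← zero_sub, h.quadraticChar_sub_comm, sub_zero, h4, hb1]

theorem quadraticChar_map_sub_map (h : IsNormalizedPreserver f K) {a b : F}
    (ha : quadraticChar F a = 1) (hb : quadraticChar F b = -1) :
    quadraticChar F (f a - f b) = quadraticChar F (a - b) := by
  have hne : a - b ≠ 0 := by
    intro h0
    rw [sub_eq_zero.1 h0, hb] at ha
    norm_num at ha
  rcases quadraticChar_dichotomy hne with hab | hab
  · rw [hab, h.quadraticChar_sub_comm]
    rw [h.quadraticChar_sub_comm] at hab
    exact h.map_sub_eq_one ha hab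
  · have := h.mul_map_sub_eq_one ha hb hab
    rw [h.quadraticChar_map, hb] at this
    rw [hab]
    linarith

theorem eq_of_map_eq (h : IsNormalizedPreserver f K) {a b : F} (ha : quadraticChar F a = 1)
    (hb : quadraticChar F b = 1) (hab : f a = f b) : a = b := by
  refine eq_of_quadraticChar_sub_eq h.ringChar_ne (e := 1) (by norm_num) ha hb fun x hx => ?_
  rw [h.quadraticChar_sub_comm, h.quadraticChar_sub_comm x, ← h.quadraticChar_map_sub_map ha hx,
    ← h.quadraticChar_map_sub_map hb hx, hab]

theorem exists_map_eq (h : IsNormalizedPreserver f K) (P : Finset F)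
    (hP : ∀ x ∈ P, quadraticChar F x = 1) (hmaps : ∀ x ∈ P, f x ∈ P) {y : F} (hy : y ∈ P) :
    ∃ x ∈ P, f x = y := by
  have hinj : Set.InjOn f P := fun a ha b hb hab => h.eq_of_map_eq (hP a ha) (hP b hb) hab
  have hsub : P.image f ⊆ P := image_subset_iff.2 hmaps
  have := eq_of_subset_of_card_le hsub (card_image_of_injOn hinj).ge
  rw [← this] at hy
  exact mem_image.1 hy

theorem map_mul_of_sq_left (h : IsNormalizedPreserver f K) {s b : F}
    (hs : quadraticChar F s = 1) (hb : quadraticChar F b = -1) : f (s * b) = f s * f b := by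
  have hfs := h.pos s hs
  have hfs0 := ne_zero_of_quadraticChar_eq_one hfs
  have hsb : quadraticChar F (s * b) = -1 := by rw [map_mul, hs, hb, one_mul]
  have key : f (s * b) / f s = f b := by
    refine eq_of_quadraticChar_sub_eq h.ringChar_ne (e := -1) (by norm_num) ?_ ?_ fun x hx => ?_
    · have : quadraticChar F (f (s * b) / f s) * quadraticChar F (f s) = -1 := by
        rw [← map_mul, div_mul_cancel₀ _ hfs0, h.quadraticChar_map, hsb]
      rwa [hfs, mul_one] at this
    · rw [h.quadraticChar_map, hb]
    · rw [neg_neg] at hx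
      obtain ⟨a, ha, rfl⟩ := h.exists_map_eq (univ.filter fun x => quadraticChar F x = 1)
        (by simp) (by simpa using h.pos) (y := x) (by simpa using hx)
      have ha : quadraticChar F a = 1 := by simpa using ha
      have hsa : quadraticChar F (s * a) = 1 := by rw [map_mul, hs, ha, one_mul]
      rw [h.quadraticChar_map_sub_map ha hb, ← one_mul (quadraticChar F (f a - f (s * b) / f s)),
        ← hfs, ← map_mul, mul_sub, mul_div_cancel₀ _ hfs0, ← h.map_mul_of_sq hs ha,
        h.quadraticChar_map_sub_map hsa hsb, ← mul_sub, map_mul, hs, one_mul]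
  rw [← key, mul_div_cancel₀ _ hfs0]

theorem map_mul' (h : IsNormalizedPreserver f K) {a b : F} (ha : a ≠ 0) (hb : b ≠ 0) :
    f (a * b) = f a * f b := by
  rcases quadraticChar_dichotomy ha with ha1 | ha1 <;>
    rcases quadraticChar_dichotomy hb with hb1 | hb1
  · exact h.map_mul_of_sq ha1 hb1
  · exact h.map_mul_of_sq_left ha1 hb1
  · rw [mul_comm, h.map_mul_of_sq_left hb1 ha1, mul_comm]
  · have hs : quadraticChar F (b / a) = 1 := by
      have : quadraticChar F (b / a) * quadraticChar F a = quadraticChar F b := by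
        rw [← map_mul, div_mul_cancel₀ _ ha]
      rw [ha1, hb1] at this
      linarith
    have h1 := h.map_mul_of_sq_left hs ha1
    rw [div_mul_cancel₀ _ ha] at h1
    rw [h1, show a * b = b / a * a ^ 2 by field_simp,
      h.map_mul_of_sq hs (quadraticChar_sq_one' ha), h.map_sq ha]
    ring

theorem quadraticChar_map_sub_one (h : IsNormalizedPreserver f K) (x : F) :
    quadraticChar F (f x - 1) = quadraticChar F (x - 1) := by
  have h1 : quadraticChar F (1 : F) = 1 := _root_.map_one _
  rcases eq_or_ne x 0 with rfl | hx
  · rw [h.map_zero]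
  rcases quadraticChar_dichotomy hx with hx1 | hx1
  · rcases eq_or_ne x 1 with rfl | hne
    · rw [h.map_one]
    rcases quadraticChar_dichotomy (sub_ne_zero.2 hne) with hx2 | hx2
    · rw [hx2, ← h.map_one]
      exact h.map_sub_eq_one h1 hx2
    · have hfx : f x - 1 ≠ 0 := by
        intro h0
        rw [sub_eq_zero, ← h.map_one] at h0
        exact hne (h.eq_of_map_eq hx1 h1 h0)
      rcases quadraticChar_dichotomy hfx with hx3 | hx3
      · obtain ⟨y, hy, hyx⟩ := h.exists_map_eq
          (univ.filter fun x => quadraticChar F x = 1 ∧ quadraticChar F (x - 1) = 1)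
          (by simp +contextual) (by
            simp only [mem_filter, mem_univ, true_and]
            rintro y ⟨hy, hy1⟩
            refine ⟨h.pos y hy, ?_⟩
            rw [← h.map_one]
            exact h.map_sub_eq_one h1 hy1) (y := f x)
          (mem_filter.2 ⟨mem_univ _, h.pos x hx1, hx3⟩)
        simp only [mem_filter, mem_univ, true_and] at hy
        rw [h.eq_of_map_eq hy.1 hx1 hyx, hx2] at hy
        norm_num at hy
      · rw [hx2, hx3]
  · rw [h.quadraticChar_sub_comm, h.quadraticChar_sub_comm x, ← h.quadraticChar_map_sub_map h1 hx1,
      h.map_one]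

theorem exists_eq_pow (h : IsNormalizedPreserver f K) : ∃ d : ℕ, ∀ x, f x = x ^ d := by
  obtain ⟨n, hn⟩ := exists_eq_pow_of_map_mul h.map_one (fun x hx => h.map_ne_zero hx)
    (fun x y hx hy => h.map_mul' hx hy)
  refine ⟨n + (Fintype.card F - 1), fun x => ?_⟩
  rcases eq_or_ne x 0 with rfl | hx
  · have := Fintype.one_lt_card (α := F)
    rw [h.map_zero, zero_pow (by omega)]
  · rw [hn x hx, pow_add, FiniteField.pow_card_sub_one_eq_one x hx, mul_one]

end IsNormalizedPreserver

end Preserver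

end

theorem isPos_iff_quadraticChar {F : Type*} [Field F] [Fintype F] [DecidableEq F] (x : F) :
    IsPos x ↔ quadraticChar F x = 1 := by
  constructor
  · rintro ⟨y, hy, rfl⟩
    exact quadraticChar_sq_one' hy
  · intro hx
    have hx0 := ne_zero_of_quadraticChar_eq_one hx
    obtain ⟨y, rfl⟩ := (quadraticChar_one_iff_isSquare hx0).1 hx
    exact ⟨y, left_ne_zero_of_mul hx0, sq y⟩

theorem isPosDef_two_iff_s5 {F : Type*} [Field F] (A : Matrix (Fin 2) (Fin 2) F) :
    IsPosDef A ↔ A 0 1 = A 1 0 ∧ IsPos (A 0 0) ∧ IsPos (A 0 0 * A 1 1 - A 0 1 * A 1 0) := by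
  have h1 : leadingMinor A 0 = A 0 0 := by
    simp [leadingMinor, Matrix.det_unique]
  have h2 : leadingMinor A 1 = A 0 0 * A 1 1 - A 0 1 * A 1 0 := by
    exact Matrix.det_fin_two A
  rw [IsPosDef, Fin.forall_fin_two, h1, h2, Matrix.IsSymm.ext_iff]
  simp [Fin.forall_fin_two, eq_comm]

theorem PreservesPos.isPos_map {F : Type*} [Field F] {f : F → F} (hf : PreservesPos 2 f)
    {a b c : F} (ha : IsPos a) (hdet : IsPos (a * c - b ^ 2)) :
    IsPos (f a) ∧ IsPos (f a * f c - f b ^ 2) := by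
  have := hf !![a, b; b, c] ((isPosDef_two_iff_s5 _).2 (by simpa [← sq] using ⟨ha, hdet⟩))
  rw [isPosDef_two_iff_s5] at this
  simpa [entrywiseMap, ← sq] using this

/-- over `F = 𝔽_{p^k}` with `q ≡ 1 (mod 4)` and `q = r²` a perfect square
(`r` odd), if `f` preserves positivity on `M_2(F)`, then `f x = a x^{p^j}` for some
`a ∈ F⁺` and `0 ≤ j ≤ k − 1`. -/
theorem stmt5 {F : Type*} [Field F] [Fintype F] (p k : ℕ) (hp : p.Prime)
    (hcard : Fintype.card F = p ^ k) (hq : Fintype.card F % 4 = 1)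
    (hsq : ∃ r : ℕ, Odd r ∧ Fintype.card F = r ^ 2) (f : F → F)
    (hpres : PreservesPos 2 f) :
    ∃ (a : F) (j : ℕ), IsPos a ∧ j ≤ k - 1 ∧ ∀ x : F, f x = a * x ^ p ^ j := by
  classical
  have : Fact p.Prime := ⟨hp⟩
  obtain ⟨r, hr, hcardr⟩ := hsq
  have hone := Fintype.one_lt_card (α := F)
  obtain ⟨n, -, hn⟩ : ∃ n ≤ k, r = p ^ n := (Nat.dvd_prime_pow hp).1
    (by rw [← hcard, hcardr]; exact dvd_pow_self r two_ne_zero)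
  have hn0 : 0 < n := by
    rcases Nat.eq_zero_or_pos n with rfl | h
    · rw [hcardr, hn] at hone
      simp at hone
    · exact h
  have hk : k = n * 2 := by
    rw [hcard, hn, ← pow_mul] at hcardr
    exact Nat.pow_right_injective hp.two_le hcardr
  have hodd : Odd p := (Nat.odd_pow_iff hn0.ne').1 (hn ▸ hr)
  have hchar : CharP F p := by
    have h2 : ((p ^ k : ℕ) : F) = 0 := by rw [← hcard]; exact Nat.cast_card_eq_zero F
    rw [Nat.cast_pow] at h2
    exact (CharP.charP_iff_prime_eq_zero hp).2 (eq_zero_of_pow_eq_zero h2)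
  have hF : ringChar F ≠ 2 := by
    rw [ringChar.eq F p]
    rintro rfl
    exact absurd hodd (by decide)
  have hq8 : Fintype.card F % 8 = 1 := by
    rw [hcardr]
    have : r % 8 = 1 ∨ r % 8 = 3 ∨ r % 8 = 5 ∨ r % 8 = 7 := by
      have := Nat.odd_iff.1 hr
      omega
    rcases this with h | h | h | h <;> simp [Nat.pow_mod, h]
  obtain ⟨K, hK, hK0, hK1, hKclique⟩ := exists_clique_card_eq_sqrt hodd hn0 hn hcardr
  have hpos1 : ∀ a, quadraticChar F a = 1 → quadraticChar F (f a) = 1 := by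
    intro a ha
    have h1 := (isPos_iff_quadraticChar a).2 ha
    obtain ⟨y, hy, hya⟩ := h1
    have := (hpres.isPos_map (a := a) (b := 0) (c := 1) ⟨y, hy, hya⟩ ⟨y, hy, by simp [hya]⟩).1
    exact (isPos_iff_quadraticChar _).1 this
  have hf1 := hpos1 1 (map_one _)
  have hf10 := ne_zero_of_quadraticChar_eq_one hf1
  have hscale : ∀ x, quadraticChar F x = quadraticChar F (f 1 * x) := by
    intro x
    rw [map_mul, hf1, one_mul]
  have hnorm : IsNormalizedPreserver (fun x => f x / f 1) K :=
    { ringChar_ne := hF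
      neg_one := (quadraticChar_one_iff_isSquare (by simp)).2
        (FiniteField.isSquare_neg_one_iff.2 (by omega))
      two := (quadraticChar_one_iff_isSquare (Ring.two_ne_zero hF)).2
        (FiniteField.isSquare_two_iff.2 (by omega))
      card_eq := by rw [hK, hcardr]
      two_le := by
        rw [hK]
        by_contra! hlt
        have : r ≤ 1 := by omega
        have : r ^ 2 ≤ 1 ^ 2 := Nat.pow_le_pow_left this 2
        omega
      zero_mem := hK0
      one_mem := hK1
      clique := hKclique
      map_one := div_self hf10
      pos := by
        intro a ha
        rw [hscale, mul_div_cancel₀ _ hf10]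
        exact hpos1 a ha
      minor := by
        intro a b c ha hdet
        have := (isPos_iff_quadraticChar _).1 (hpres.isPos_map ((isPos_iff_quadraticChar _).2 ha)
          ((isPos_iff_quadraticChar _).2 hdet)).2
        rw [hscale, hscale]
        convert this using 2
        field_simp }
  obtain ⟨d, hd⟩ := hnorm.exists_eq_pow
  obtain ⟨j, hj, hdj⟩ := exists_pow_eq_frobenius_of_quadraticChar (F := F) (d := d) hodd
    (by omega) hcard fun x => by rw [← hnorm.quadraticChar_map_sub_one x, hd]
  refine ⟨f 1, j, (isPos_iff_quadraticChar _).2 hf1, by omega, fun x => ?_⟩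
  rw [← hdj, ← hd, mul_div_cancel₀ _ hf10]
end
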